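/- arXiv:1711.03909 — 3 statements merged into one kernel-verified Lean document; each statement's English description precedes it below -/
import Mathlib

section
/- Let X be an algebraic variety of dimension d > 0 over an algebraically closed field k, and let x be a closed point of X. Then the Krull dimension of the Riemann–Zariski space RZ(X,x) (the supremum of lengths of chains of irreducible closed subspaces) equals d − 1. -/
open AlgebraicGeometry CategoryTheory

universe u

noncomputable section

/-- The homomorphism `𝒪_{X,x} → K` from the stalk at a point to the function field of an
integral scheme. -/
def stalkToFunctionField (X : Scheme.{u}) [IsIntegral X] (x : X) :
    X.presheaf.stalk x →+* X.functionField :=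
  algebraMap (X.presheaf.stalk x) X.functionField

/-- A point of the Riemann–Zariski space attached to a local ring `R` and a field `K`
(via `φ : R → K`): (the equivalence class of) a valuation of `K`, encoded by its
valuation ring, a valuation subring of `K` which *dominates* `R`, i.e. contains `φ(R)`
and whose maximal ideal pulls back to the maximal ideal of `R`.  (Such a valuation is
automatically trivial on any field contained in `R`.) -/
structure RZPoint {R K : Type u} [CommRing R] [IsLocalRing R] [Field K]
    (φ : R →+* K) where
  val : ValuationSubring K
  dom_le : ∀ a : R, φ a ∈ val
  dom_lt : ∀ a ∈ IsLocalRing.maximalIdeal R,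
    (⟨φ a, dom_le a⟩ : val) ∈ IsLocalRing.maximalIdeal val

/-- The Zariski topology on the Riemann–Zariski space: it is generated by the basic
open sets `E(f₁,…,f_m) = {ν | f₁,…,f_m ∈ R_ν}`, equivalently by the `E(f)`, `f ∈ K`. -/
instance {R K : Type u} [CommRing R] [IsLocalRing R] [Field K] (φ : R →+* K) :
    TopologicalSpace (RZPoint φ) :=
  TopologicalSpace.generateFrom {s | ∃ f : K, s = {v : RZPoint φ | f ∈ v.val}}

/-- The Riemann–Zariski space `RZ(X,x)` of an (integral) algebraic variety `X` at a
point `x`: the space of all valuations of the function field `K` of `X` extending the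
trivial valuation of the base field (this is automatic) whose valuation ring dominates
the local ring `𝒪_{X,x}`, with the Zariski topology. -/
def RZ (X : Scheme.{u}) [IsIntegral X] (x : X) : Type u :=
  RZPoint (stalkToFunctionField X x)

instance (X : Scheme.{u}) [IsIntegral X] (x : X) : TopologicalSpace (RZ X x) :=
  inferInstanceAs (TopologicalSpace (RZPoint (stalkToFunctionField X x)))

theorem MvPolynomial.height_of_isMaximal {k : Type*} [Field k] (n : ℕ)
    (P : Ideal (MvPolynomial (Fin n) k)) [hP : P.IsMaximal] : P.height = n := by
  induction n with
  | zero =>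
    let e := MvPolynomial.isEmptyAlgEquiv k (Fin 0)
    have : P = ⊥ := by
      have h : (P.map e.toRingEquiv) = ⊥ := by
        rcases Ideal.eq_bot_or_top (P.map e.toRingEquiv) with h | h
        · exact h
        · exact absurd h (Ideal.map_isMaximal_of_equiv e.toRingEquiv).ne_top
      exact (Ideal.map_eq_bot_iff_of_injective e.toRingEquiv.injective).mp h
    subst this
    simp
  | succ n ih =>
    let e := (MvPolynomial.finSuccEquiv k n).toRingEquiv
    have h1 : (P.map e).IsMaximal := Ideal.map_isMaximal_of_equiv e
    have h2 : ((P.map e).comap (Polynomial.C)).IsMaximal :=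
      Polynomial.isMaximal_comap_C_of_isJacobsonRing (P.map e)
    have : (P.map e).LiesOver ((P.map e).comap (Polynomial.C)) := ⟨rfl⟩
    rw [← e.height_map P, Polynomial.height_eq_height_add_one ((P.map e).comap (Polynomial.C)), ih]
    simp

theorem PrimeSpectrum.comap_strictMono_of_isIntegral {A B : Type*} [CommRing A] [CommRing B]
    [Algebra A B] [Algebra.IsIntegral A B] :
    StrictMono (PrimeSpectrum.comap (algebraMap A B)) :=
  fun _ _ h ↦ Ideal.IsIntegral.comap_lt_comap h

theorem exists_trdeg_eq_ringKrullDim_eq_height (k : Type u) [Field k] (B : Type u) [CommRing B]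
    [IsDomain B] [Algebra k B] [Algebra.FiniteType k B] :
    ∃ s : ℕ, Algebra.trdeg k B = s ∧ ringKrullDim B = s ∧
      ∀ P : Ideal B, P.IsMaximal → P.height = s := by
  obtain ⟨s, g, hg, hint⟩ := exists_integral_inj_algHom_of_fg k B
  let A := MvPolynomial (Fin s) k
  let _ : Algebra A B := g.toRingHom.toAlgebra
  have : IsScalarTower k A B := IsScalarTower.of_algHom g
  have : Algebra.IsIntegral A B := ⟨hint⟩
  have : FaithfulSMul A B := (faithfulSMul_iff_algebraMap_injective A B).mpr hg
  have hle : ringKrullDim B ≤ s := by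
    refine (Order.krullDim_le_of_strictMono _
      (PrimeSpectrum.comap_strictMono_of_isIntegral (A := A) (B := B))).trans ?_
    exact (MvPolynomial.ringKrullDim_of_isNoetherianRing (R := k) (ι := Fin s)).le.trans (by simp)
  have hht : ∀ P : Ideal B, P.IsMaximal → P.height = s := by
    intro P hP
    refine le_antisymm ?_ ?_
    · have := (Ideal.height_le_ringKrullDim_of_isPrime (I := P)).trans hle
      exact_mod_cast this
    · have hm : (P.comap (algebraMap A B)).IsMaximal :=
        Ideal.isMaximal_comap_of_isIntegral_of_isMaximal P
      have : P.LiesOver (P.comap (algebraMap A B)) := ⟨rfl⟩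
      have := Algebra.FiniteType.isNoetherianRing k B
      rw [Ideal.height_eq_height_add_of_liesOver_of_hasGoingDown (P.comap (algebraMap A B)) P,
        MvPolynomial.height_of_isMaximal s]
      exact le_self_add
  refine ⟨s, ?_, ?_, hht⟩
  · have := trdeg_add_eq k A (A := B)
    have h0 : Algebra.trdeg A B = 0 := trdeg_eq_zero
    rw [← this, h0]
    simp [A]
  · refine le_antisymm hle ?_
    obtain ⟨P, hP⟩ := Ideal.exists_maximal B
    have h := Ideal.height_le_ringKrullDim_of_isPrime (I := P)
    rw [hht P hP] at h
    exact_mod_cast h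

theorem ringKrullDim_le_of_trdeg_le (k : Type u) [Field k] (A : Type u) [CommRing A]
    [IsDomain A] [Algebra k A] (d : ℕ) (hd : Algebra.trdeg k A ≤ d) : ringKrullDim A ≤ d := by
  refine iSup_le fun p ↦ ?_
  have hex : ∀ i : Fin p.length, ∃ y, y ∈ (p i.succ).asIdeal ∧ y ∉ (p i.castSucc).asIdeal :=
    fun i ↦ SetLike.exists_of_lt (p.strictMono i.castSucc_lt_succ)
  choose y hy hy' using hex
  let C := Algebra.adjoin k (Set.range y)
  have hC : Algebra.FiniteType k C := by
    exact Subalgebra.fg_iff_finiteType _ |>.mp ⟨(Set.finite_range y).toFinset, by simp [C]⟩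
  obtain ⟨s, hs, hs', -⟩ := exists_trdeg_eq_ringKrullDim_eq_height k C
  have hsd : s ≤ d := by
    have := (trdeg_le_of_injective C.val Subtype.val_injective).trans hd
    rw [hs] at this
    exact_mod_cast this
  let q : LTSeries (PrimeSpectrum C) :=
    { length := p.length
      toFun := fun i ↦ PrimeSpectrum.comap (algebraMap C A) (p i)
      step := fun i ↦ by
        refine lt_of_le_of_ne (Ideal.comap_mono (p.strictMono i.castSucc_lt_succ).le) fun h ↦ ?_
        have hyC : y i ∈ C := Algebra.subset_adjoin (Set.mem_range_self i)
        have h1 : (⟨y i, hyC⟩ : C) ∈ (p i.succ).asIdeal.comap (algebraMap C A) := hy i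
        exact hy' i (h.ge h1) }
  have := Order.LTSeries.length_le_krullDim q
  calc ((p.length : ℕ) : WithBot ℕ∞) ≤ ringKrullDim C := this
    _ = s := hs'
    _ ≤ d := by exact_mod_cast hsd

/-- The valuation subring `V` of `K` is centered at the ideal `P` of `S` along `f : S →+* K`. -/
structure ValuationSubring.IsCenteredAt {S K : Type*} [CommRing S] [Field K] (f : S →+* K)
    (P : Ideal S) (V : ValuationSubring K) : Prop where
  map_mem : ∀ s, f s ∈ V
  mem_iff : ∀ s, s ∈ P ↔ f s ∈ V.nonunits

namespace ValuationSubring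

variable {S K : Type*} [CommRing S] [Field K] {f : S →+* K}

/-- The composite of a valuation subring `V` with a valuation subring of its residue field. -/
def composite (V : ValuationSubring K) (A : ValuationSubring (IsLocalRing.ResidueField V)) :
    ValuationSubring K where
  toSubring := (A.toSubring.comap (IsLocalRing.residue V)).map V.subtype
  mem_or_inv_mem' x := by
    have key : ∀ y : K, y⁻¹ ∉ V →
        y ∈ (A.toSubring.comap (IsLocalRing.residue V)).map V.subtype := by
      intro y hy
      obtain ⟨h1, h2⟩ := V.mem_nonunits_iff_exists_mem_maximalIdeal.mp
        (V.mem_nonunits_iff_or.mpr (Or.inr hy))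
      refine ⟨⟨y, h1⟩, ?_, rfl⟩
      simp [(IsLocalRing.residue_eq_zero_iff _).mpr h2]
    by_cases hx : x ∈ V
    · by_cases hx' : x⁻¹ ∈ V
      · by_cases h0 : x = 0
        · left; simp [h0]
        have e : IsLocalRing.residue V ⟨x⁻¹, hx'⟩ = (IsLocalRing.residue V ⟨x, hx⟩)⁻¹ := by
          refine eq_inv_of_mul_eq_one_left ?_
          rw [← map_mul, ← map_one (IsLocalRing.residue V)]
          congr 1
          ext
          simp [h0]
        rcases A.mem_or_inv_mem (IsLocalRing.residue V ⟨x, hx⟩) with h | h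
        · exact Or.inl ⟨⟨x, hx⟩, h, rfl⟩
        · exact Or.inr ⟨⟨x⁻¹, hx'⟩, show IsLocalRing.residue V ⟨x⁻¹, hx'⟩ ∈ A from e ▸ h, rfl⟩
      · exact Or.inl (key x hx')
    · exact Or.inr (key x⁻¹ (by rwa [inv_inv]))

theorem mem_composite {V : ValuationSubring K} {A : ValuationSubring (IsLocalRing.ResidueField V)}
    {x : K} : x ∈ V.composite A ↔ ∃ h : x ∈ V, IsLocalRing.residue V ⟨x, h⟩ ∈ A := by
  constructor
  · rintro ⟨y, hy, rfl⟩
    exact ⟨y.2, hy⟩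
  · rintro ⟨h, hA⟩
    exact ⟨⟨x, h⟩, hA, rfl⟩

theorem composite_le {V : ValuationSubring K} {A : ValuationSubring (IsLocalRing.ResidueField V)} :
    V.composite A ≤ V :=
  fun _ hx ↦ (mem_composite.mp hx).1

theorem coe_mem_nonunits_composite {V : ValuationSubring K}
    {A : ValuationSubring (IsLocalRing.ResidueField V)} (x : V) :
    (x : K) ∈ (V.composite A).nonunits ↔ IsLocalRing.residue V x ∈ A.nonunits := by
  rw [mem_nonunits_iff_or, mem_nonunits_iff_or, mem_composite, IsLocalRing.residue_eq_zero_iff,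
    ← coe_mem_nonunits_iff, mem_nonunits_iff_or]
  by_cases h0 : (x : K) = 0
  · simp [h0]
  by_cases h : (x : K)⁻¹ ∈ V
  · have e : IsLocalRing.residue V ⟨_, h⟩ = (IsLocalRing.residue V x)⁻¹ := by
      refine eq_inv_of_mul_eq_one_left ?_
      rw [← map_mul, ← map_one (IsLocalRing.residue V)]
      congr 1
      ext
      simp [h0]
    simp [h, h0, e]
  · simp [h]

theorem IsCenteredAt.exists_le {V : ValuationSubring K} {P Q : Ideal S} [Q.IsPrime]
    (hV : V.IsCenteredAt f P) (hPQ : P ≤ Q) : ∃ W ≤ V, W.IsCenteredAt f Q := by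
  let ρ : S →+* IsLocalRing.ResidueField V :=
    (IsLocalRing.residue V).comp (f.codRestrict V.toSubring hV.map_mem)
  have hρ : ∀ s, ρ s = IsLocalRing.residue V ⟨f s, hV.map_mem s⟩ := fun _ ↦ rfl
  have hu : ∀ s : Q.primeCompl, IsUnit (ρ s) := by
    rintro ⟨s, hs⟩
    rw [isUnit_iff_ne_zero, hρ, Ne, IsLocalRing.residue_eq_zero_iff, ← coe_mem_nonunits_iff,
      ← hV.mem_iff]
    exact fun h ↦ hs (hPQ h)
  let g : Localization.AtPrime Q →+* IsLocalRing.ResidueField V := IsLocalization.lift hu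
  have hg : ∀ s, g (algebraMap S _ s) = ρ s := IsLocalization.lift_eq hu
  obtain ⟨A, hA, hloc⟩ := IsLocalRing.exists_factor_valuationRing g
  refine ⟨V.composite A, composite_le, fun s ↦ ?_, fun s ↦ ?_⟩
  · exact mem_composite.mpr ⟨hV.map_mem s, hg s ▸ hA _⟩
  · have h : g (algebraMap S _ s) ∈ A.nonunits ↔ _ :=
      coe_mem_nonunits_iff (a := ⟨g (algebraMap S _ s), hA _⟩)
    rw [coe_mem_nonunits_composite ⟨f s, hV.map_mem s⟩, ← hρ, ← hg, h,
      ← IsLocalization.AtPrime.to_map_mem_maximal_iff (Localization.AtPrime Q) Q s,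
      IsLocalRing.mem_maximalIdeal, IsLocalRing.mem_maximalIdeal, _root_.mem_nonunits_iff,
      _root_.mem_nonunits_iff,
      not_iff_not]
    exact (isUnit_map_iff (g.codRestrict A.toSubring hA) _).symm

theorem isCenteredAt_top (hf : Function.Injective f) :
    (⊤ : ValuationSubring K).IsCenteredAt f ⊥ where
  map_mem _ := mem_top _
  mem_iff s := by
    rw [mem_nonunits_iff_or]
    simp [map_eq_zero_iff f hf]

theorem exists_isCenteredAt (hf : Function.Injective f) (P : Ideal S) [P.IsPrime] :
    ∃ V : ValuationSubring K, V.IsCenteredAt f P :=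
  let ⟨W, _, hW⟩ := (isCenteredAt_top hf).exists_le (bot_le : ⊥ ≤ P)
  ⟨W, hW⟩

theorem exists_antitone_isCenteredAt (hf : Function.Injective f) (p : ℕ → PrimeSpectrum S)
    (hp : Monotone p) : ∃ V : ℕ → ValuationSubring K, Antitone V ∧
      ∀ i, (V i).IsCenteredAt f (p i).asIdeal := by
  let T (i : ℕ) := {V : ValuationSubring K // V.IsCenteredAt f (p i).asIdeal}
  have step (i : ℕ) (V : T i) : ∃ W : T (i + 1), W.1 ≤ V.1 :=
    let ⟨W, h, hW⟩ := V.2.exists_le (Q := (p (i + 1)).asIdeal) (hp i.le_succ)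
    ⟨⟨W, hW⟩, h⟩
  choose next hnext using step
  obtain ⟨V₀, hV₀⟩ := exists_isCenteredAt hf (p 0).asIdeal
  let V (i : ℕ) : T i := Nat.rec ⟨V₀, hV₀⟩ next i
  exact ⟨fun i ↦ (V i).1, antitone_nat_of_succ_le fun i ↦ hnext i (V i), fun i ↦ (V i).2⟩

end ValuationSubring

theorem RZPoint.val_injective {R K : Type u} [CommRing R] [IsLocalRing R] [Field K]
    {φ : R →+* K} : Function.Injective (RZPoint.val (φ := φ)) := by
  rintro ⟨V, _, _⟩ ⟨W, _, _⟩ rfl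
  rfl

theorem RZPoint.isOpen_setOf_mem {R K : Type u} [CommRing R] [IsLocalRing R] [Field K]
    (φ : R →+* K) (f : K) : IsOpen {v : RZPoint φ | f ∈ v.val} :=
  TopologicalSpace.isOpen_generateFrom_of_mem ⟨f, rfl⟩

theorem RZPoint.specializes_iff {R K : Type u} [CommRing R] [IsLocalRing R] [Field K]
    {φ : R →+* K} {v w : RZPoint φ} : v ⤳ w ↔ w.val ≤ v.val := by
  refine ⟨fun h f hf ↦ h.mem_open (isOpen_setOf_mem φ f) hf, fun h ↦ ?_⟩
  rw [Specializes, TopologicalSpace.nhds_generateFrom, TopologicalSpace.nhds_generateFrom]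
  refine biInf_mono ?_
  rintro _ ⟨hw, f, rfl⟩
  exact ⟨h hw, f, rfl⟩

instance RZPoint.t0Space {R K : Type u} [CommRing R] [IsLocalRing R] [Field K] (φ : R →+* K) :
    T0Space (RZPoint φ) where
  t0 _ _ h := val_injective
    (le_antisymm (specializes_iff.mp h.specializes') (specializes_iff.mp h.specializes))

theorem RZPoint.exists_mem_of_isIrreducible {R K : Type u} [CommRing R] [IsLocalRing R] [Field K]
    {φ : R →+* K} {Z : Set (RZPoint φ)} (hZ : IsIrreducible Z) (s : Finset K)
    (hs : ∀ f ∈ s, ∃ v ∈ Z, f ∈ v.val) : ∃ v ∈ Z, ∀ f ∈ s, f ∈ v.val := by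
  classical
  have := isIrreducible_iff_sInter.mp hZ (s.image fun f ↦ {v : RZPoint φ | f ∈ v.val})
  simp only [Finset.mem_image, forall_exists_index, and_imp, forall_apply_eq_imp_iff₂] at this
  obtain ⟨v, hv, h⟩ := this (fun f _ ↦ isOpen_setOf_mem φ f) hs
  exact ⟨v, hv, fun f hf ↦ h _ (by simpa using ⟨f, hf, rfl⟩)⟩

/-- The generic point of an irreducible closed subset of the Riemann–Zariski space: its valuation
ring is the union of the valuation rings of the points of the subset. -/
def RZPoint.ofIsIrreducible {R K : Type u} [CommRing R] [IsLocalRing R] [Field K]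
    {φ : R →+* K} {Z : Set (RZPoint φ)} (hZ : IsIrreducible Z) : RZPoint φ where
  val :=
    { carrier := {f | ∃ v ∈ Z, f ∈ v.val}
      mul_mem' := by
        classical
        intro a b ha hb
        obtain ⟨v, hv, h⟩ := exists_mem_of_isIrreducible hZ {a, b} (by simp [ha.out, hb.out])
        exact ⟨v, hv, mul_mem (h a (by simp)) (h b (by simp))⟩
      add_mem' := by
        classical
        intro a b ha hb
        obtain ⟨v, hv, h⟩ := exists_mem_of_isIrreducible hZ {a, b} (by simp [ha.out, hb.out])
        exact ⟨v, hv, add_mem (h a (by simp)) (h b (by simp))⟩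
      one_mem' := hZ.nonempty.imp fun v hv ↦ ⟨hv, one_mem _⟩
      zero_mem' := hZ.nonempty.imp fun v hv ↦ ⟨hv, zero_mem _⟩
      neg_mem' := fun ⟨v, hv, h⟩ ↦ ⟨v, hv, neg_mem h⟩
      mem_or_inv_mem' := fun f ↦ by
        obtain ⟨v, hv⟩ := hZ.nonempty
        exact (v.val.mem_or_inv_mem f).imp (⟨v, hv, ·⟩) (⟨v, hv, ·⟩) }
  dom_le a := hZ.nonempty.imp fun v hv ↦ ⟨hv, v.dom_le a⟩
  dom_lt a ha := by
    rw [← ValuationSubring.coe_mem_nonunits_iff, ValuationSubring.mem_nonunits_iff_or]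
    by_contra! h
    obtain ⟨h0, v, hv, h⟩ := h
    have := v.dom_lt a ha
    rw [← ValuationSubring.coe_mem_nonunits_iff, ValuationSubring.mem_nonunits_iff_or] at this
    exact this.elim h0 fun h' ↦ h' h

instance RZPoint.quasiSober {R K : Type u} [CommRing R] [IsLocalRing R] [Field K] (φ : R →+* K) :
    QuasiSober (RZPoint φ) where
  sober {Z} hZ hZc := by
    refine ⟨ofIsIrreducible hZ, ?_⟩
    refine isGenericPoint_def.mpr (subset_antisymm ?_ ?_)
    · rw [hZc.closure_subset_iff, Set.singleton_subset_iff]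
      refine closure_subset_iff_isClosed.mpr hZc (mem_closure_iff.mpr fun U hU hmem ↦ ?_)
      obtain ⟨_, ⟨s, ⟨hs, hs'⟩, rfl⟩, hm, hsub⟩ :=
        (TopologicalSpace.isTopologicalBasis_of_subbasis rfl).exists_subset_of_mem_open hmem hU
      obtain ⟨v, hv, h⟩ := isIrreducible_iff_sInter.mp hZ hs.toFinset
        (fun u hu ↦ TopologicalSpace.isOpen_generateFrom_of_mem (hs' (hs.mem_toFinset.mp hu)))
        (fun u hu ↦ by
          obtain ⟨f, rfl⟩ := hs' (hs.mem_toFinset.mp hu)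
          exact hm _ (hs.mem_toFinset.mp hu))
      exact ⟨v, hsub (by simpa using h), hv⟩
    · exact fun v hv ↦ specializes_iff_mem_closure.mp
        (specializes_iff.mpr fun f hf ↦ ⟨v, hv, hf⟩)

theorem RZPoint.topologicalKrullDim_eq_krullDim {R K : Type u} [CommRing R] [IsLocalRing R]
    [Field K] (φ : R →+* K) :
    let _ : PartialOrder (RZPoint φ) := PartialOrder.lift RZPoint.val val_injective
    topologicalKrullDim (RZPoint φ) = Order.krullDim (RZPoint φ) := by
  intro _
  let e : TopologicalSpace.IrreducibleCloseds (RZPoint φ) ≃ RZPoint φ :=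
    (irreducibleSetEquivPoints (α := RZPoint φ)).toEquiv
  refine Order.krullDim_eq_of_orderIso (⟨e, ?_⟩ : _ ≃o RZPoint φ)
  intro a b
  refine Iff.trans ?_ (irreducibleSetEquivPoints (α := RZPoint φ)).map_rel_iff'
  exact specializes_iff.symm

theorem ValuationSubring.length_le_ringKrullDim {K : Type*} [Field K]
    (q : LTSeries (ValuationSubring K)) : q.length ≤ ringKrullDim q.head := by
  let r : LTSeries {V : ValuationSubring K // q.head ≤ V} :=
    { length := q.length
      toFun := fun i ↦ ⟨q i, LTSeries.head_le q i⟩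
      step := fun i ↦ q.step i }
  have h := Order.LTSeries.length_le_krullDim r
  rwa [← Order.krullDim_eq_of_orderIso (primeSpectrumOrderEquiv q.head),
    Order.krullDim_orderDual] at h

theorem trdeg_eq_of_isFractionRing (k B K : Type u) [Field k] [CommRing B] [IsDomain B] [Field K]
    [Algebra k B] [Algebra B K] [Algebra k K] [IsScalarTower k B K] [IsFractionRing B K] :
    Algebra.trdeg k K = Algebra.trdeg k B := by
  have : Algebra.IsAlgebraic B K := IsLocalization.isAlgebraic _ (nonZeroDivisors B)
  rw [← trdeg_add_eq k B (A := K), trdeg_eq_zero (R := B), add_zero]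

section

variable {B R K : Type u} [CommRing B] [CommRing R] [IsLocalRing R] [Field K] [Algebra B R]
  [Algebra B K] [Algebra R K] [IsScalarTower B R K]

theorem RZPoint.isCenteredAt (n : Ideal B) [n.IsPrime] [IsLocalization.AtPrime R n]
    (v : RZPoint (algebraMap R K)) : v.val.IsCenteredAt (algebraMap B K) n where
  map_mem b := IsScalarTower.algebraMap_apply B R K b ▸ v.dom_le _
  mem_iff b := by
    rw [IsScalarTower.algebraMap_apply B R K,
      ← IsLocalization.AtPrime.to_map_mem_maximal_iff R n b]
    refine ⟨fun h ↦ ValuationSubring.coe_mem_nonunits_iff.mpr (v.dom_lt _ h), fun h ↦ ?_⟩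
    rw [IsLocalRing.mem_maximalIdeal, _root_.mem_nonunits_iff]
    intro hu
    obtain ⟨h', h⟩ := ValuationSubring.mem_nonunits_iff_exists_mem_maximalIdeal.mp h
    exact h (hu.map ((algebraMap R K).codRestrict v.val.toSubring v.dom_le))

/-- The point of the Riemann–Zariski space of the localization of `B` at `n` given by a valuation
subring centered at `n`. -/
def RZPoint.ofIsCenteredAt (n : Ideal B) [n.IsPrime] [IsLocalization.AtPrime R n]
    (V : ValuationSubring K) (hV : V.IsCenteredAt (algebraMap B K) n) :
    RZPoint (algebraMap R K) :=
  have key (b : B) (s : n.primeCompl) : algebraMap R K (IsLocalization.mk' R b s) =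
      algebraMap B K b * (algebraMap B K s)⁻¹ := by
    have hs : algebraMap R K (algebraMap B R s) ≠ 0 :=
      ((IsLocalization.map_units R s).map (algebraMap R K)).ne_zero
    rw [IsScalarTower.algebraMap_apply B R K, IsScalarTower.algebraMap_apply B R K,
      ← IsLocalization.mk'_spec R b s, map_mul, mul_inv_cancel_right₀ hs]
  have inv_mem (s : n.primeCompl) : (algebraMap B K s)⁻¹ ∈ V := by
    by_contra h
    exact s.2 ((hV.mem_iff s).mpr (V.mem_nonunits_iff_or.mpr (Or.inr h)))
  have le (a : R) : algebraMap R K a ∈ V := by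
    obtain ⟨b, s, rfl⟩ := IsLocalization.exists_mk'_eq n.primeCompl a
    exact key b s ▸ mul_mem (hV.map_mem b) (inv_mem s)
  { val := V
    dom_le := le
    dom_lt a ha := by
      obtain ⟨b, s, rfl⟩ := IsLocalization.exists_mk'_eq n.primeCompl a
      rw [IsLocalization.AtPrime.mk'_mem_maximal_iff R n b s, hV.mem_iff] at ha
      obtain ⟨h, hb⟩ := ValuationSubring.mem_nonunits_iff_exists_mem_maximalIdeal.mp ha
      convert Ideal.mul_mem_right ⟨_, inv_mem s⟩ _ hb
      exact key b s }

theorem RZPoint.topologicalKrullDim_le {k : Type u} [Field k] [IsDomain B] [Algebra k B]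
    [Algebra k K] [IsScalarTower k B K] [IsFractionRing B K] (n : Ideal B) [n.IsPrime]
    [IsLocalization.AtPrime R n] (hn : n ≠ ⊥) (d : ℕ) (hd : Algebra.trdeg k B ≤ d) :
    topologicalKrullDim (RZPoint (algebraMap R K)) ≤ (d - 1 : ℕ) := by
  let _ : PartialOrder (RZPoint (algebraMap R K)) := PartialOrder.lift RZPoint.val val_injective
  rw [topologicalKrullDim_eq_krullDim]
  refine iSup_le fun p ↦ ?_
  let q : LTSeries (ValuationSubring K) := p.map RZPoint.val fun _ _ h ↦ h
  have hlt : q.last < ⊤ := by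
    refine lt_top_iff_ne_top.mpr fun h ↦ ?_
    obtain ⟨b, hb, hb0⟩ := Submodule.exists_mem_ne_zero_of_ne_bot hn
    have := ((p.last.isCenteredAt n).mem_iff b).mp hb
    rw [show p.last.val = ⊤ from h, ValuationSubring.mem_nonunits_iff_or] at this
    simp [hb0] at this
  let r : LTSeries (ValuationSubring K) := RelSeries.snoc q ⊤ hlt
  have hmem (c : k) : algebraMap k K c ∈ r.head := by
    rw [IsScalarTower.algebraMap_apply k B K, RelSeries.head_snoc]
    exact (p.head.isCenteredAt n).map_mem _
  let _ : Algebra k r.head := ((algebraMap k K).codRestrict r.head.toSubring hmem).toAlgebra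
  let f : r.head →ₐ[k] K := { r.head.subtype with commutes' := fun _ ↦ rfl }
  have htr := trdeg_le_of_injective f Subtype.val_injective
  rw [trdeg_eq_of_isFractionRing k B K] at htr
  have hlen : ((p.length + 1 : ℕ) : WithBot ℕ∞) ≤ d :=
    (ValuationSubring.length_le_ringKrullDim r).trans
      (ringKrullDim_le_of_trdeg_le k _ d (htr.trans hd))
  norm_cast at hlen ⊢
  omega

theorem WithBot.natCast_sub_one_le {n : ℕ} {x : WithBot ℕ∞} (hx : x ≠ ⊥)
    (h : ((n : ℕ∞) : WithBot ℕ∞) ≤ x + 1) : ((n - 1 : ℕ) : WithBot ℕ∞) ≤ x := by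
  lift x to ℕ∞ using hx
  norm_cast at h
  change (((n - 1 : ℕ) : ℕ∞) : WithBot ℕ∞) ≤ x
  rw [WithBot.coe_le_coe, ENat.natCast_sub]
  exact tsub_le_iff_right.mpr h

theorem ValuationSubring.exists_fg_subalgebra_of_fg [IsDomain B] [IsFractionRing B K] {n : Ideal B}
    (hfg : n.FG) (hn : n ≠ ⊥) (V : ValuationSubring K) (hV : ∀ b, algebraMap B K b ∈ V) :
    ∃ (S : Subalgebra B K) (a : B), S.FG ∧ a ∈ n ∧ (∀ s ∈ S, s ∈ V) ∧
      ∀ b ∈ n, ∃ s ∈ S, algebraMap B K b = s * algebraMap B K a := by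
  classical
  obtain ⟨T, rfl⟩ := hfg
  have hinj := IsFractionRing.injective B K
  have hT : T.Nonempty := by
    rw [Finset.nonempty_iff_ne_empty]
    rintro rfl
    simp at hn
  obtain ⟨a, haT, ha⟩ := T.exists_max_image (fun b ↦ V.valuation (algebraMap B K b)) hT
  have ha0 : a ≠ 0 := by
    rintro rfl
    refine hn (Ideal.span_eq_bot.mpr fun b hb ↦ ?_)
    have := ha b hb
    simpa [map_eq_zero_iff _ hinj] using this
  have haK : algebraMap B K a ≠ 0 := by rwa [Ne, map_eq_zero_iff _ hinj]
  let F : Finset K := T.image fun b ↦ algebraMap B K b * (algebraMap B K a)⁻¹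
  let V' : Subalgebra B K := { V.toSubring with algebraMap_mem' := hV }
  refine ⟨Algebra.adjoin B F, a, ⟨F, rfl⟩, Ideal.subset_span haT, ?_, fun b hb ↦ ?_⟩
  · refine fun s hs ↦ (Algebra.adjoin_le (S := V') ?_) hs
    intro f hf
    obtain ⟨b, hb, rfl⟩ := Finset.mem_image.mp (Finset.mem_coe.mp hf)
    refine (V.valuation_le_one_iff _).mp ?_
    rw [map_mul, map_inv₀]
    exact mul_inv_le_one_of_le₀ (ha b hb) zero_le
  · induction hb using Submodule.span_induction with
    | mem b hb =>
      refine ⟨_, Algebra.subset_adjoin (Finset.mem_coe.mpr (Finset.mem_image_of_mem _ hb)), ?_⟩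
      rw [inv_mul_cancel_right₀ haK]
    | zero => exact ⟨0, Subalgebra.zero_mem _, by simp⟩
    | add x y _ _ hx hy =>
      obtain ⟨s, hs, h⟩ := hx
      obtain ⟨t, ht, h'⟩ := hy
      exact ⟨s + t, Subalgebra.add_mem _ hs ht, by rw [map_add, h, h', add_mul]⟩
    | smul c x _ hx =>
      obtain ⟨s, hs, h⟩ := hx
      exact ⟨algebraMap B K c * s, Subalgebra.mul_mem _ (Subalgebra.algebraMap_mem _ c) hs,
        by rw [smul_eq_mul, map_mul, h, mul_assoc]⟩

theorem RZPoint.le_topologicalKrullDim {k : Type u} [Field k] [IsDomain B] [Algebra k B]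
    [Algebra.FiniteType k B] [Algebra k K] [IsScalarTower k B K] [IsFractionRing B K] (n : Ideal B)
    [hmax : n.IsMaximal] [IsLocalization.AtPrime R n] (hn : n ≠ ⊥) (d : ℕ)
    (hd : Algebra.trdeg k B = d) :
    (d - 1 : ℕ) ≤ topologicalKrullDim (RZPoint (algebraMap R K)) := by
  let _ : PartialOrder (RZPoint (algebraMap R K)) := PartialOrder.lift RZPoint.val val_injective
  rw [topologicalKrullDim_eq_krullDim]
  have := Algebra.FiniteType.isNoetherianRing k B
  have hinj := IsFractionRing.injective B K
  obtain ⟨V₀, hV₀⟩ := ValuationSubring.exists_isCenteredAt hinj n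
  obtain ⟨S, a, hS, han, hSV, hSn⟩ := ValuationSubring.exists_fg_subalgebra_of_fg
    (IsNoetherian.noetherian n) hn V₀ hV₀.map_mem
  have : Algebra.FiniteType B S := S.fg_iff_finiteType.mp hS
  have : Algebra.FiniteType k S := .trans (S := B) inferInstance inferInstance
  have := Algebra.FiniteType.isNoetherianRing k S
  obtain ⟨s, hs, -, hheight⟩ := exists_trdeg_eq_ringKrullDim_eq_height k S
  have hsd : s = d := by
    have h1 := trdeg_le_of_injective (IsScalarTower.toAlgHom k B S) fun x y h ↦ hinj
      (congrArg Subtype.val h)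
    have h2 := trdeg_le_of_injective (S.val.restrictScalars k) Subtype.val_injective
    rw [trdeg_eq_of_isFractionRing k B K] at h2
    exact_mod_cast hs.symm.trans (le_antisymm h2 h1) |>.trans hd
  subst hsd
  have hne : Ideal.span {algebraMap B S a} ≠ ⊤ := by
    rw [Ne, Ideal.span_singleton_eq_top]
    intro hu
    obtain ⟨t, ht⟩ := hu.exists_right_inv
    have h1 : algebraMap B K a * t = 1 := congrArg Subtype.val ht
    have h2 := (hV₀.mem_iff a).mp han
    rw [ValuationSubring.mem_nonunits_iff_or, inv_eq_of_mul_eq_one_right h1] at h2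
    rcases h2 with h2 | h2
    · simp [h2] at h1
    · exact h2 (hSV _ t.2)
  obtain ⟨P, hP, haP⟩ := Ideal.exists_le_maximal _ hne
  have hdim := Ideal.height_le_ringKrullDim_quotient_add_one
    (haP (Ideal.mem_span_singleton_self (algebraMap B S a)))
  rw [hheight P hP] at hdim
  have hle : ((s - 1 : ℕ) : WithBot ℕ∞) ≤ ringKrullDim (S ⧸ Ideal.span {algebraMap B S a}) := by
    have := Ideal.Quotient.nontrivial_iff.mpr hne
    have hnonneg := ringKrullDim_nonneg_of_nontrivial (R := S ⧸ Ideal.span {algebraMap B S a})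
    exact WithBot.natCast_sub_one_le (ne_bot_of_le_ne_bot (by simp) hnonneg) hdim
  obtain ⟨p, hp⟩ := Order.le_krullDim_iff.mp hle
  let q (i : ℕ) : PrimeSpectrum S := PrimeSpectrum.comap (Ideal.Quotient.mk _)
    (p ⟨min i p.length, by omega⟩)
  have hq : Monotone q := fun i j hij ↦ Ideal.comap_mono
    (p.strictMono.monotone (by simpa using Or.inl hij))
  have hq' (i j : ℕ) (hij : i < j) (hj : j ≤ p.length) : q i ≠ q j := by
    intro h
    have := PrimeSpectrum.comap_injective_of_surjective _ Ideal.Quotient.mk_surjective h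
    have := p.strictMono.injective this
    simp at this
    omega
  have haq (i : ℕ) : algebraMap B S a ∈ (q i).asIdeal := by
    have h : Ideal.Quotient.mk (Ideal.span {algebraMap B S a}) (algebraMap B S a) = 0 :=
      Ideal.Quotient.eq_zero_iff_mem.mpr (Ideal.mem_span_singleton_self _)
    change Ideal.Quotient.mk _ _ ∈ (p _).asIdeal
    rw [h]
    exact Ideal.zero_mem _
  obtain ⟨V, hV, hVc⟩ := ValuationSubring.exists_antitone_isCenteredAt
    (f := S.val.toRingHom) Subtype.val_injective q hq
  have hnq (i : ℕ) : (q i).asIdeal.comap (algebraMap B S) = n := by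
    refine (hmax.eq_of_le (Ideal.IsPrime.ne_top inferInstance) fun b hb ↦ ?_).symm
    obtain ⟨t, ht, h⟩ := hSn b hb
    have : algebraMap B S b = ⟨t, ht⟩ * algebraMap B S a := Subtype.ext h
    rw [Ideal.mem_comap, this]
    exact Ideal.mul_mem_left _ _ (haq i)
  have hVn (i : ℕ) : (V i).IsCenteredAt (algebraMap B K) n :=
    { map_mem := fun b ↦ (hVc i).map_mem (algebraMap B S b)
      mem_iff := fun b ↦ by
        rw [← hnq i]
        exact (hVc i).mem_iff (algebraMap B S b) }
  have hVlt (i j : ℕ) (hij : i < j) (hj : j ≤ p.length) : V j < V i := by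
    refine lt_of_le_of_ne (hV hij.le) fun h ↦ hq' i j hij hj ?_
    ext t
    rw [(hVc i).mem_iff, (hVc j).mem_iff, h]
  let r : LTSeries (RZPoint (algebraMap R K)) := LTSeries.mk p.length
    (fun i ↦ ofIsCenteredAt n (V (p.length - i)) (hVn _)) fun i j hij ↦
      hVlt (p.length - j) (p.length - i) (by omega) (by omega)
  exact hp ▸ Order.LTSeries.length_le_krullDim r

theorem RZPoint.topologicalKrullDim_eq {k : Type u} [Field k] [IsDomain B] [Algebra k B]
    [Algebra.FiniteType k B] [Algebra k K] [IsScalarTower k B K] [IsFractionRing B K] (n : Ideal B)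
    [hmax : n.IsMaximal] [IsLocalization.AtPrime R n] (d : ℕ) (hd : 0 < d)
    (hdim : ringKrullDim B = d) :
    topologicalKrullDim (RZPoint (algebraMap R K)) = (d - 1 : ℕ) := by
  obtain ⟨s, hs, hs', hheight⟩ := exists_trdeg_eq_ringKrullDim_eq_height k B
  obtain rfl : s = d := by exact_mod_cast hs'.symm.trans hdim
  have hn : n ≠ ⊥ := by
    rintro rfl
    have := hheight ⊥ hmax
    rw [Ideal.height_bot] at this
    norm_cast at this
    omega
  exact le_antisymm (topologicalKrullDim_le n hn s hs.le) (le_topologicalKrullDim n hn s hs)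

end

namespace AlgebraicGeometry.Scheme

variable {k : Type u} [Field k] {X : Scheme.{u}} (f : X ⟶ Spec (CommRingCat.of k))

/-- The structure map from the base ring to the sections of a scheme over an affine base. -/
def baseToSections (U : X.Opens) : k →+* Γ(X, U) :=
  ((ΓSpecIso (CommRingCat.of k)).inv ≫ f.appLE ⊤ U le_top).hom

theorem baseToSections_finiteType [LocallyOfFiniteType f] {U : X.Opens} (hU : IsAffineOpen U) :
    (baseToSections f U).FiniteType :=
  (f.finiteType_appLE (isAffineOpen_top _) hU le_top).comp
    (.of_surjective _ (ConcreteCategory.bijective_of_isIso (ΓSpecIso (CommRingCat.of k)).inv).2)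

variable [IsIntegral X]

/-- The structure map from the base ring to the function field of an integral scheme over an affine
base. -/
def baseToFunctionField : k →+* X.functionField :=
  (X.presheaf.germ ⊤ (genericPoint X) trivial).hom.comp (baseToSections f ⊤)

theorem baseToFunctionField_eq (U : X.Opens) [Nonempty U] :
    baseToFunctionField f = (X.germToFunctionField U).hom.comp (baseToSections f U) := by
  have h : f.appLE ⊤ ⊤ le_top ≫ X.presheaf.map (homOfLE (le_top : U ≤ ⊤)).op = f.appLE ⊤ U le_top :=
    f.appLE_map _ _
  rw [baseToFunctionField, baseToSections, baseToSections, ← h, germToFunctionField,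
    ← X.presheaf.germ_res (homOfLE (le_top : U ≤ ⊤))]
  rfl

theorem exists_trdeg_functionField_eq_ringKrullDim [LocallyOfFiniteType f] {U : X.Opens}
    (hU : IsAffineOpen U) [Nonempty U] :
    ∃ s : ℕ, (let _ := (baseToFunctionField f).toAlgebra; Algebra.trdeg k X.functionField = s) ∧
      ringKrullDim Γ(X, U) = s := by
  let _ := (baseToFunctionField f).toAlgebra
  let _ := (baseToSections f U).toAlgebra
  have : Algebra.FiniteType k Γ(X, U) := baseToSections_finiteType f hU
  have : IsScalarTower k Γ(X, U) X.functionField := .of_algebraMap_eq' (baseToFunctionField_eq f U)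
  have := functionField_isFractionRing_of_isAffineOpen X U hU
  obtain ⟨s, hs, hs', -⟩ := exists_trdeg_eq_ringKrullDim_eq_height k Γ(X, U)
  exact ⟨s, (trdeg_eq_of_isFractionRing k Γ(X, U) X.functionField).trans hs, hs'⟩

theorem ringKrullDim_eq_of_isAffineOpen [LocallyOfFiniteType f] {U V : X.Opens}
    (hU : IsAffineOpen U) (hV : IsAffineOpen V) [Nonempty U] [Nonempty V] :
    ringKrullDim Γ(X, U) = ringKrullDim Γ(X, V) := by
  obtain ⟨s, hs, hs'⟩ := exists_trdeg_functionField_eq_ringKrullDim f hU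
  obtain ⟨t, ht, ht'⟩ := exists_trdeg_functionField_eq_ringKrullDim f hV
  have : s = t := by exact_mod_cast hs.symm.trans ht
  rw [hs', ht', this]

theorem ringKrullDim_eq_topologicalKrullDim [LocallyOfFiniteType f] {U : X.Opens}
    (hU : IsAffineOpen U) [Nonempty U] : ringKrullDim Γ(X, U) = topologicalKrullDim X := by
  refine le_antisymm ?_ ?_
  · rw [← PrimeSpectrum.topologicalKrullDim_eq_ringKrullDim]
    exact hU.fromSpec.isOpenEmbedding.isInducing.topologicalKrullDim_le
  · have : topologicalKrullDim X = Order.krullDim X :=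
      Order.krullDim_eq_of_orderIso (irreducibleSetEquivPoints (α := X))
    rw [this, Order.krullDim_eq_iSup_coheight]
    refine iSup_le fun z ↦ ?_
    obtain ⟨V, hV, hzV, -⟩ := exists_isAffineOpen_mem_and_subset (x := z) (U := ⊤) trivial
    have : Nonempty V := ⟨⟨z, hzV⟩⟩
    let _ : Algebra Γ(X, V) (X.presheaf.stalk z) := (X.presheaf.germ V z hzV).hom.toAlgebra
    have : IsLocalization.AtPrime (X.presheaf.stalk z) (hV.primeIdealOf ⟨z, hzV⟩).asIdeal :=
      hV.isLocalization_stalk ⟨z, hzV⟩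
    rw [← ringKrullDim_stalk_eq_coheight z, ringKrullDim_eq_of_isAffineOpen f hU hV]
    have := IsLocalization.AtPrime.ringKrullDim_eq_height
      (hV.primeIdealOf ⟨z, hzV⟩).asIdeal (X.presheaf.stalk z)
    rw [this]
    exact Ideal.height_le_ringKrullDim_of_isPrime

end AlgebraicGeometry.Scheme

/-- Let `X` be an algebraic variety of dimension `d > 0` over an
algebraically closed field `k` (an integral scheme, separated and of finite type over
`k`), and let `x` be a closed point of `X`.  Then the Krull dimension of the topological
space `RZ(X,x)` (the supremum of lengths of chains of irreducible closed subspaces)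
equals `d - 1`. -/
theorem statement_0 {k : Type u} [Field k] [IsAlgClosed k]
    (X : Scheme.{u}) [IsIntegral X] (sπ : X ⟶ Spec (CommRingCat.of k))
    [IsSeparated sπ] [LocallyOfFiniteType sπ] [QuasiCompact sπ]
    (d : ℕ) (hd : 0 < d) (hdim : topologicalKrullDim X = d)
    (x : X) (hx : IsClosed ({x} : Set X)) :
    topologicalKrullDim (RZ X x) = ((d - 1 : ℕ) : WithBot ℕ∞) := by
  obtain ⟨U, hU, hxU, -⟩ := exists_isAffineOpen_mem_and_subset (x := x) (U := ⊤) trivial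
  have : Nonempty U := ⟨⟨x, hxU⟩⟩
  let _ := (Scheme.baseToFunctionField sπ).toAlgebra
  let _ := (Scheme.baseToSections sπ U).toAlgebra
  have : Algebra.FiniteType k Γ(X, U) := Scheme.baseToSections_finiteType sπ hU
  have : IsScalarTower k Γ(X, U) X.functionField :=
    .of_algebraMap_eq' (Scheme.baseToFunctionField_eq sπ U)
  have := functionField_isFractionRing_of_isAffineOpen X U hU
  let _ : Algebra Γ(X, U) (X.presheaf.stalk x) := (X.presheaf.germ U x hxU).hom.toAlgebra
  have : IsScalarTower Γ(X, U) (X.presheaf.stalk x) X.functionField :=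
    functionField_isScalarTower X U ⟨x, hxU⟩
  have : IsLocalization.AtPrime (X.presheaf.stalk x) (hU.primeIdealOf ⟨x, hxU⟩).asIdeal :=
    hU.isLocalization_stalk ⟨x, hxU⟩
  have := hU.primeIdealOf_isMaximal_of_isClosed ⟨x, hxU⟩ hx
  exact RZPoint.topologicalKrullDim_eq (k := k) (hU.primeIdealOf ⟨x, hxU⟩).asIdeal d hd
    ((Scheme.ringKrullDim_eq_topologicalKrullDim sπ hU).trans hdim)

end
end

section
/- Let A be a noetherian integral domain containing a field k and let 𝔪 be a maximal ideal of A. Let j : A → A_𝔪 be the canonical homomorphism to the localization at 𝔪. Then the map from V(A_𝔪, 𝔪A_𝔪) to V(A,𝔪) sending ν to ν∘j is a homeomorphism. -/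
open scoped ENNReal

/-- A *centered semivaluation* of a ring `A` equipped with a ring homomorphism
`φ : k →+* A` from a field `k`. -/
def IsCenteredSemival {k A : Type*} [Field k] [CommRing A] (φ : k →+* A)
    (ν : A → ℝ≥0∞) : Prop :=
  ν 0 = ⊤ ∧ (∀ c : k, c ≠ 0 → ν (φ c) = 0) ∧
    (∀ f g : A, ν (f * g) = ν f + ν g) ∧
    ∀ f g : A, min (ν f) (ν g) ≤ ν (f + g)

/-- The value `ν(I) = min { ν f | f ∈ I }` of a (semi)valuation on an ideal `I`. -/
noncomputable def evalIdeal {A : Type*} [CommRing A] (ν : A → ℝ≥0∞) (I : Ideal A) : ℝ≥0∞ :=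
  ⨅ f ∈ I, ν f

/-- The space `V(A,𝔪)` of centered semivaluations normalized by `ν(𝔪) = 1`,
with the topology of pointwise convergence. -/
def NormSemivalSpace {k A : Type*} [Field k] [CommRing A] (φ : k →+* A) (I : Ideal A) :
    Type _ :=
  {ν : A → ℝ≥0∞ // IsCenteredSemival φ ν ∧ evalIdeal ν I = 1}

instance NormSemivalSpace.instTopologicalSpace {k A : Type*} [Field k] [CommRing A]
    (φ : k →+* A) (I : Ideal A) : TopologicalSpace (NormSemivalSpace φ I) :=
  TopologicalSpace.induced Subtype.val Pi.topologicalSpace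

theorem NormSemivalSpace.continuous_val {k A : Type*} [Field k] [CommRing A] (φ : k →+* A)
    (I : Ideal A) : Continuous fun ν : NormSemivalSpace φ I => ν.1 :=
  continuous_induced_dom

namespace IsCenteredSemival

variable {k A B : Type*} [Field k] [CommRing A] [CommRing B] {φ : k →+* A} {ν : A → ℝ≥0∞}

theorem map_zero (h : IsCenteredSemival φ ν) : ν 0 = ⊤ := h.1

theorem map_mul (h : IsCenteredSemival φ ν) (f g : A) : ν (f * g) = ν f + ν g := h.2.2.1 f g

theorem min_le_map_add (h : IsCenteredSemival φ ν) (f g : A) : min (ν f) (ν g) ≤ ν (f + g) :=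
  h.2.2.2 f g

theorem map_one (h : IsCenteredSemival φ ν) : ν 1 = 0 := by
  simpa using h.2.1 1 one_ne_zero

theorem map_eq_zero_of_isUnit (h : IsCenteredSemival φ ν) {u : A} (hu : IsUnit u) : ν u = 0 := by
  obtain ⟨v, hv⟩ := hu.exists_right_inv
  have := h.map_mul u v
  rw [hv, h.map_one] at this
  exact (add_eq_zero.mp this.symm).1

theorem map_eq_zero_of_notMem (h : IsCenteredSemival φ ν) {𝔪 : Ideal A} [𝔪.IsMaximal]
    (h1 : evalIdeal ν 𝔪 = 1) {s : A} (hs : s ∉ 𝔪) : ν s = 0 := by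
  obtain ⟨a, m, hm, ham⟩ := Ideal.IsMaximal.exists_inv (I := 𝔪) ‹_› hs
  have hνm : 1 ≤ ν m := h1 ▸ iInf₂_le m hm
  have hmin := h.min_le_map_add (a * s) m
  rw [ham, h.map_one, h.map_mul] at hmin
  rcases min_le_iff.mp hmin with h0 | h0
  · exact (add_eq_zero.mp (le_antisymm h0 zero_le)).2
  · exact absurd (hνm.trans h0) (by simp)

/-- The pullback of a centered semivaluation along a ring homomorphism. -/
theorem comp {ψ : A →+* B} {μ : B → ℝ≥0∞} (h : IsCenteredSemival (ψ.comp φ) μ) :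
    IsCenteredSemival φ fun f => μ (ψ f) :=
  ⟨by simpa using h.map_zero, h.2.1, fun f g => by simpa using h.map_mul (ψ f) (ψ g),
    fun f g => by simpa using h.min_le_map_add (ψ f) (ψ g)⟩

section Localization

variable [Algebra A B] (𝔪 : Ideal A)

/-- The value of an ideal is unchanged by extension to the localization at a prime. -/
theorem evalIdeal_map [𝔪.IsPrime] [IsLocalization.AtPrime B 𝔪] {ψ : k →+* B} {μ : B → ℝ≥0∞}
    (h : IsCenteredSemival ψ μ) :
    evalIdeal μ (𝔪.map (algebraMap A B)) = evalIdeal (fun f => μ (algebraMap A B f)) 𝔪 := by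
  refine le_antisymm (le_iInf₂ fun f hf => iInf₂_le _ (Ideal.mem_map_of_mem _ hf))
    (le_iInf₂ fun x hx => ?_)
  obtain ⟨⟨a, s⟩, hxs⟩ := (IsLocalization.mem_map_algebraMap_iff 𝔪.primeCompl B).mp hx
  have hμ := h.map_mul x (algebraMap A B s)
  rw [hxs, h.map_eq_zero_of_isUnit (IsLocalization.map_units B s), add_zero] at hμ
  exact hμ ▸ iInf₂_le (a : A) a.2

/-- The extension of a function on `A` to the localization of `A` at a prime, given by
evaluation at a numerator. -/
noncomputable def localize (B : Type*) [CommRing B] [Algebra A B] [𝔪.IsPrime]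
    [IsLocalization.AtPrime B 𝔪] (ν : A → ℝ≥0∞) (x : B) : ℝ≥0∞ :=
  ν (IsLocalization.sec 𝔪.primeCompl x).1

variable {𝔪} [𝔪.IsMaximal] [IsLocalization.AtPrime B 𝔪]

theorem localize_eq (h : IsCenteredSemival φ ν) (h1 : evalIdeal ν 𝔪 = 1) {x : B} {a s : A}
    (hs : s ∉ 𝔪) (hx : x * algebraMap A B s = algebraMap A B a) : localize 𝔪 B ν x = ν a := by
  have hsec := IsLocalization.sec_spec 𝔪.primeCompl x
  set p := IsLocalization.sec 𝔪.primeCompl x with hp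
  have heq : algebraMap A B (p.1 * s) = algebraMap A B (a * p.2) := by
    rw [_root_.map_mul, _root_.map_mul, ← hsec, ← hx]
    ring
  obtain ⟨c, hc⟩ := IsLocalization.exists_of_eq (M := 𝔪.primeCompl) heq
  have hν := congrArg ν hc
  simpa [h.map_mul, h.map_eq_zero_of_notMem h1 c.2, h.map_eq_zero_of_notMem h1 hs,
    h.map_eq_zero_of_notMem h1 p.2.2, localize, ← hp] using hν

theorem localize_algebraMap (h : IsCenteredSemival φ ν) (h1 : evalIdeal ν 𝔪 = 1) (f : A) :
    localize 𝔪 B ν (algebraMap A B f) = ν f :=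
  h.localize_eq h1 (s := 1) 𝔪.primeCompl.one_mem (by simp)

theorem isCenteredSemival_localize (h : IsCenteredSemival φ ν) (h1 : evalIdeal ν 𝔪 = 1) :
    IsCenteredSemival ((algebraMap A B).comp φ) (localize 𝔪 B ν) := by
  refine ⟨?_, fun c hc => ?_, fun x y => ?_, fun x y => ?_⟩
  · rw [← _root_.map_zero (algebraMap A B), h.localize_algebraMap h1, h.map_zero]
  · rw [RingHom.comp_apply, h.localize_algebraMap h1, h.2.1 c hc]
  all_goals
    obtain ⟨⟨a, s⟩, hx⟩ := IsLocalization.surj 𝔪.primeCompl x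
    obtain ⟨⟨b, t⟩, hy⟩ := IsLocalization.surj 𝔪.primeCompl y
    dsimp only at hx hy
    rw [h.localize_eq h1 s.2 hx, h.localize_eq h1 t.2 hy]
  · rw [h.localize_eq h1 (s * t).2 (a := a * b) (by
      rw [Submonoid.coe_mul, _root_.map_mul, _root_.map_mul, ← hx, ← hy]; ring), h.map_mul]
  · rw [h.localize_eq h1 (s * t).2 (a := a * t + b * s) (by
      simp only [Submonoid.coe_mul, _root_.map_mul, map_add, ← hx, ← hy]; ring)]
    simpa [h.map_mul, h.map_eq_zero_of_notMem h1 s.2, h.map_eq_zero_of_notMem h1 t.2] using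
      h.min_le_map_add (a * t) (b * s)

theorem localize_comp_algebraMap {ψ : k →+* B} {μ : B → ℝ≥0∞} (h : IsCenteredSemival ψ μ) :
    localize 𝔪 B (fun f => μ (algebraMap A B f)) = μ := by
  funext x
  have hμ := h.map_mul x (algebraMap A B (IsLocalization.sec 𝔪.primeCompl x).2)
  rwa [IsLocalization.sec_spec 𝔪.primeCompl x,
    h.map_eq_zero_of_isUnit (IsLocalization.map_units B _), add_zero] at hμ

theorem evalIdeal_localize (h : IsCenteredSemival φ ν) (h1 : evalIdeal ν 𝔪 = 1) :
    evalIdeal (localize 𝔪 B ν) (𝔪.map (algebraMap A B)) = 1 := by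
  rw [(h.isCenteredSemival_localize h1).evalIdeal_map 𝔪, ← h1]
  simp only [h.localize_algebraMap h1]

end Localization

end IsCenteredSemival

/-- Let `A` be a noetherian integral domain containing a field `k` and
let `𝔪` be a maximal ideal of `A`.  Let `j : A → A_𝔪` be the canonical homomorphism to
the localization at `𝔪` (modelled by any ring `B` with `IsLocalization.AtPrime B 𝔪`).
Then the map `V(A_𝔪, 𝔪A_𝔪) → V(A,𝔪)` sending `ν` to `ν ∘ j` is a homeomorphism. -/
theorem statement_3 {k A B : Type*} [Field k] [CommRing A] [IsDomain A] [IsNoetherianRing A]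
    [Algebra k A] (𝔪 : Ideal A) [𝔪.IsMaximal]
    [CommRing B] [Algebra A B] [IsLocalization.AtPrime B 𝔪] :
    ∃ Φ : NormSemivalSpace ((algebraMap A B).comp (algebraMap k A))
            (𝔪.map (algebraMap A B)) ≃ₜ
          NormSemivalSpace (algebraMap k A) 𝔪,
      ∀ ν f, (Φ ν).1 f = ν.1 (algebraMap A B f) := by
  refine ⟨{
    toFun := fun ν => ⟨fun f => ν.1 (algebraMap A B f), ν.2.1.comp,
      ν.2.1.evalIdeal_map 𝔪 ▸ ν.2.2⟩
    invFun := fun ν => ⟨IsCenteredSemival.localize 𝔪 B ν.1,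
      ν.2.1.isCenteredSemival_localize ν.2.2, ν.2.1.evalIdeal_localize ν.2.2⟩
    left_inv := fun ν => Subtype.ext ν.2.1.localize_comp_algebraMap
    right_inv := fun ν => Subtype.ext (funext fun f => ν.2.1.localize_algebraMap ν.2.2 f)
    continuous_toFun := continuous_induced_rng.mpr <| continuous_pi fun f =>
      (continuous_apply (algebraMap A B f)).comp (NormSemivalSpace.continuous_val _ _)
    continuous_invFun := continuous_induced_rng.mpr <| continuous_pi fun x =>
      (continuous_apply (IsLocalization.sec 𝔪.primeCompl x).1).comp (NormSemivalSpace.continuous_val _ _) },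
    fun _ _ => rfl⟩
end

section
/- Let X be an algebraic variety over an algebraically closed field k, with function field K, and let x ∈ X be a closed point at which X is analytically irreducible. Let R̃ be the henselization of R = O_{X,x}, an integral domain with fraction field K̃, and let RZ̃(X,x) be the space of valuations of K̃ whose valuation ring dominates R̃, with the Zariski topology. Then the map RZ̃(X,x) → RZ(X,x) sending ν̃ to its restriction ν̃∘ρ along the inclusion ρ : K ↪ K̃ is a homeomorphism. -/
open AlgebraicGeometry CategoryTheory

universe u

noncomputable section

section

open Polynomial IsLocalRing

theorem ValuationSubring.eval_divX_iterate_mem {E : Type*} [Field E] {p : E[X]} {x : E}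
    (hx : p.eval x = 0) (O : ValuationSubring E) (hp : ∀ j, p.coeff j ∈ O) (j : ℕ) :
    (divX^[j] p).eval x ∈ O := by
  have hcoeff (i j : ℕ) : (divX^[j] p).coeff i ∈ O := by
    induction j generalizing i with
    | zero => exact hp i
    | succ j ih => rw [Function.iterate_succ_apply', coeff_divX]; exact ih _
  rcases O.mem_or_inv_mem x with h | h
  · rw [eval_eq_sum]
    exact sum_mem fun i _ => O.mul_mem _ _ (hcoeff i j) (pow_mem h i)
  · induction j with
    | zero => simp [hx]
    | succ j ih =>
      rw [Function.iterate_succ_apply']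
      rcases eq_or_ne x 0 with rfl | hx0
      · rw [← coeff_zero_eq_eval_zero, coeff_divX]
        exact hcoeff _ _
      · have key := congrArg (eval x) (divX_mul_X_add (divX^[j] p))
        simp only [eval_add, eval_mul, eval_X, eval_C] at key
        have : (divX (divX^[j] p)).eval x
            = x⁻¹ * ((divX^[j] p).eval x - (divX^[j] p).coeff 0) := by
          rw [← key]; field_simp; ring
        rw [this]
        exact O.mul_mem _ _ h (sub_mem ih (hcoeff 0 j))

theorem ValuationSubring.exists_coeff_mem_and_coeff_eq_one {F E : Type*} [Field F] [Field E]
    [Algebra F E] (V : ValuationSubring F) {x : E} (hx : IsAlgebraic F x) :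
    ∃ p : F[X], (∀ j, p.coeff j ∈ V) ∧ (∃ i, p.coeff i = 1) ∧ aeval x p = 0 := by
  obtain ⟨p, hp, hpx⟩ := hx
  obtain ⟨i, hi, hmax⟩ := p.support.exists_max_image (fun i => V.valuation (p.coeff i))
    (by simpa using hp)
  have hi0 : p.coeff i ≠ 0 := by simpa using hi
  refine ⟨C (p.coeff i)⁻¹ * p, fun j => ?_, ⟨i, by simp [hi0]⟩, by simp [hpx]⟩
  rw [coeff_C_mul, ← V.valuation_le_one_iff, map_mul, map_inv₀]
  have hv : V.valuation (p.coeff i) ≠ 0 := by simpa using hi0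
  by_cases hj : p.coeff j = 0
  · simp [hj]
  · calc _ ≤ (V.valuation (p.coeff i))⁻¹ * V.valuation (p.coeff i) := by
          gcongr; exact hmax j (by simpa using hj)
      _ = 1 := inv_mul_cancel₀ hv

theorem ValuationSubring.isIntegral_of_forall_mem {F E : Type*} [Field F] [Field E] [Algebra F E]
    (V : ValuationSubring F) {y : E}
    (h : ∀ O : ValuationSubring E, (∀ a ∈ V, algebraMap F E a ∈ O) → y ∈ O) : IsIntegral V y := by
  by_contra hy
  have : IsIntegrallyClosedIn (integralClosure V E).toSubring E :=
    inferInstanceAs (IsIntegrallyClosedIn (integralClosure V E) E)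
  obtain ⟨O, hO, hyO⟩ := Subring.exists_le_valuationSubring_of_isIntegrallyClosedIn
    (R := (integralClosure V E).toSubring) (x := y) hy
  exact hyO (h O fun a ha => hO (algebraMap_mem (integralClosure V E) ⟨a, ha⟩))

/-- Let `W₁` and `W₂` be valuation subrings of an algebraic extension `E` of `F` lying over the
same valuation subring `V` of `F`.  If they have the same centre on the integral closure of `V`,
then they coincide. -/
theorem ValuationSubring.le_of_center_le {F E : Type*} [Field F] [Field E] [Algebra F E]
    [Algebra.IsAlgebraic F E] (V : ValuationSubring F) (W₁ W₂ : ValuationSubring E)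
    (h₂ : W₂.comap (algebraMap F E) = V)
    (h : ∀ y : E, IsIntegral V y → y ∈ W₂.nonunits → y ∈ W₁.nonunits) : W₁ ≤ W₂ := by
  intro x hx
  obtain ⟨p, hp, ⟨i, hi⟩, hpx⟩ :=
    V.exists_coeff_mem_and_coeff_eq_one (Algebra.IsAlgebraic.isAlgebraic (R := F) x)
  set q : E[X] := p.map (algebraMap F E) with hq
  have hqx : q.eval x = 0 := by rw [hq, eval_map_algebraMap]; exact hpx
  have hqcoeff (O : ValuationSubring E) (hO : ∀ a ∈ V, algebraMap F E a ∈ O) (j : ℕ) :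
      q.coeff j ∈ O := by
    rw [hq, coeff_map]; exact hO _ (hp j)
  have hO₂ : ∀ a ∈ V, algebraMap F E a ∈ W₂ := fun a ha => by
    rwa [← ValuationSubring.mem_comap, h₂]
  have hint (j : ℕ) : IsIntegral V ((divX^[j] q).eval x) :=
    V.isIntegral_of_forall_mem fun O hO => eval_divX_iterate_mem hqx O (hqcoeff O hO) j
  have hstep (j : ℕ) : (divX^[j + 1] q).eval x * x + q.coeff j = (divX^[j] q).eval x := by
    have key := congrArg (eval x) (divX_mul_X_add (divX^[j] q))
    have hc (k : ℕ) : (divX^[k] q).coeff 0 = q.coeff k := by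
      have (k l : ℕ) : (divX^[k] q).coeff l = q.coeff (l + k) := by
        induction k generalizing l with
        | zero => rfl
        | succ k ih => rw [Function.iterate_succ_apply', coeff_divX, ih]; congr 1; omega
      simpa using this k 0
    simp only [eval_add, eval_mul, eval_X, eval_C, hc] at key
    rw [Function.iterate_succ_apply', key]
  obtain ⟨j, hj⟩ : ∃ j, (divX^[j + 1] q).eval x ∉ W₁.nonunits := by
    by_contra! hall
    have hall' (j : ℕ) : W₁.valuation ((divX^[j] q).eval x) < 1 := by
      cases j with
      | zero => simp [hqx]
      | succ j => exact hall j
    have h1 : W₁.valuation (q.coeff i) < 1 := by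
      rw [eq_sub_of_add_eq' (hstep i)]
      refine Valuation.map_sub_lt _ (hall' i) ?_
      rw [map_mul]
      exact mul_lt_one_of_lt_of_le (hall' _) ((W₁.valuation_le_one_iff x).2 hx)
    simp [hq, hi] at h1
  have hb₂ : (divX^[j + 1] q).eval x ∉ W₂.nonunits := fun hh => hj (h _ (hint _) hh)
  rw [mem_nonunits_iff_or, not_or, not_not] at hb₂
  have : x = ((divX^[j + 1] q).eval x)⁻¹ * ((divX^[j] q).eval x - q.coeff j) := by
    rw [← hstep j, add_sub_cancel_right, inv_mul_cancel_left₀ hb₂.1]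
  rw [this]
  exact W₂.mul_mem _ _ hb₂.2 (sub_mem (eval_divX_iterate_mem hqx W₂ (hqcoeff W₂ hO₂) j)
    (hqcoeff W₂ hO₂ j))

theorem ValuationSubring.mem_of_isIntegral_of_le_comap {F E : Type*} [Field F] [Field E]
    [Algebra F E] {V : ValuationSubring F} {W : ValuationSubring E}
    (h : V ≤ W.comap (algebraMap F E)) {y : E} (hy : IsIntegral V y) : y ∈ W := by
  refine LocalSubring.mem_of_isMax_of_isIntegral (R := W.toLocalSubring) W.isMax_toLocalSubring ?_
  let φ : V →+* W.toLocalSubring.toSubring :=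
    ((algebraMap F E).comp V.subtype).codRestrict W.toSubring fun a => h a.2
  exact hy.map_of_comp_eq φ (RingHom.id E) rfl

theorem ValuationSubring.mem_nonunits_comap {F E : Type*} [Field F] [Field E] {f : F →+* E}
    {W : ValuationSubring E} {x : F} : x ∈ (W.comap f).nonunits ↔ f x ∈ W.nonunits := by
  simp [mem_nonunits_iff_or]

open scoped Pointwise in
theorem ValuationSubring.exists_algEquiv_mem_iff_of_isGalois {F E : Type*} [Field F] [Field E]
    [Algebra F E] [IsGalois F E] (W₁ W₂ : ValuationSubring E)
    (h : W₁.comap (algebraMap F E) = W₂.comap (algebraMap F E)) :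
    ∃ σ : E ≃ₐ[F] E, ∀ x, x ∈ W₁ ↔ σ x ∈ W₂ := by
  obtain ⟨V, hV₁⟩ : ∃ V, W₁.comap (algebraMap F E) = V := ⟨_, rfl⟩
  have hV₂ := h.symm.trans hV₁
  let B := integralClosure V E
  have hle {W : ValuationSubring E} (hW : W.comap (algebraMap F E) = V) :
      B.toSubring ≤ W.toSubring :=
    fun y hy => mem_of_isIntegral_of_le_comap hW.ge hy
  let : MulSemiringAction Gal(E/F) B := IsIntegralClosure.MulSemiringAction V F E B
  have hsmul (σ : Gal(E/F)) (b : B) : ((σ • b : B) : E) = σ b :=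
    algebraMap_galRestrict_apply V σ b
  have : SMulCommClass Gal(E/F) V B := ⟨fun σ a b => Subtype.ext <| by
    rw [hsmul]
    change σ ((a : F) • (b : E)) = (a : F) • ((σ • b : B) : E)
    rw [map_smul, hsmul]⟩
  have : Algebra.IsInvariant V B Gal(E/F) := ⟨fun b hb => by
    obtain ⟨c, hc⟩ := (InfiniteGalois.mem_range_algebraMap_iff_fixed (b : E)).2
      fun σ => by rw [← hsmul, hb σ]
    have hcV : c ∈ V := by
      rw [← hV₁, mem_comap, hc]
      exact hle hV₁ b.2
    exact ⟨⟨c, hcV⟩, Subtype.ext hc⟩⟩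
  let : TopologicalSpace B := ⊥
  have : DiscreteTopology B := ⟨rfl⟩
  have : ContinuousSMul Gal(E/F) B := by
    refine (continuousSMul_iff_stabilizer_isOpen (M := Gal(E/F)) (X := B)).2 fun b => ?_
    have := IntermediateField.adjoin.finiteDimensional
      (Algebra.IsIntegral.isIntegral (R := F) (b : E))
    refine Subgroup.isOpen_mono (H₁ := (IntermediateField.adjoin F {(b : E)}).fixingSubgroup) ?_
      (IntermediateField.fixingSubgroup_isOpen _)
    intro σ hσ
    exact Subtype.ext ((hsmul σ b).trans
      (hσ ⟨b, IntermediateField.mem_adjoin_simple_self F (b : E)⟩))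
  let P {W : ValuationSubring E} (hW : W.comap (algebraMap F E) = V) : Ideal B :=
    (maximalIdeal W).comap (Subring.inclusion (hle hW) : B.toSubring →+* W.toSubring)
  have hP {W : ValuationSubring E} (hW : W.comap (algebraMap F E) = V) (b : B) :
      b ∈ P hW ↔ (b : E) ∈ W.nonunits := (coe_mem_nonunits_iff (A := W)).symm
  have hPV {W : ValuationSubring E} (hW : W.comap (algebraMap F E) = V) (a : V) :
      a ∈ (P hW).under V ↔ (a : F) ∈ V.nonunits := by
    refine (hP hW _).trans ?_
    exact mem_nonunits_comap.symm.trans (by rw [hW]; rfl)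
  have (W) (hW) : (P (W := W) hW).IsPrime := Ideal.comap_isPrime _ _
  obtain ⟨σ, hσ⟩ := Algebra.IsInvariant.exists_smul_of_under_eq_of_profinite (A := V)
    (G := Gal(E/F)) (P hV₁) (P hV₂) (by ext a; rw [hPV hV₁, hPV hV₂])
  have hcenter (y : E) (hy : IsIntegral V y) : σ y ∈ W₂.nonunits ↔ y ∈ W₁.nonunits := by
    rw [← hsmul σ ⟨y, hy⟩, ← hP hV₂, hσ, Ideal.smul_mem_pointwise_smul_iff, hP hV₁]
  have hcomap : (W₂.comap (σ : E →+* E)).comap (algebraMap F E) = V := by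
    rw [← hV₂]; ext a; simp
  have hnon (y : E) : y ∈ (W₂.comap (σ : E →+* E)).nonunits ↔ σ y ∈ W₂.nonunits := by
    rw [mem_nonunits_comap]; rfl
  have heq : W₁ = W₂.comap (σ : E →+* E) := le_antisymm
    (le_of_center_le V _ _ hcomap fun y hy hh => (hcenter y hy).1 ((hnon y).1 hh))
    (le_of_center_le V _ _ hV₁ fun y hy hh => (hnon y).2 ((hcenter y hy).2 hh))
  refine ⟨σ, fun x => ?_⟩
  rw [heq]; rfl

theorem ValuationSubring.exists_algEquiv_mem_iff {F E : Type*} [Field F] [Field E]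
    [Algebra F E] [IsAlgClosed E] [Algebra.IsAlgebraic F E] (W₁ W₂ : ValuationSubring E)
    (h : W₁.comap (algebraMap F E) = W₂.comap (algebraMap F E)) :
    ∃ σ : E ≃ₐ[F] E, ∀ x, x ∈ W₁ ↔ σ x ∈ W₂ := by
  let q := ringExpChar F
  have : Algebra.IsAlgebraic (perfectClosure F E) E := .tower_top (K := F) _
  have : IsAlgClosure (perfectClosure F E) E := ⟨inferInstance, inferInstance⟩
  have : Normal (perfectClosure F E) E := IsAlgClosure.normal _ _
  have : IsGalois (perfectClosure F E) E :=
    { to_isSeparable := inferInstance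
      to_normal := inferInstance }
  have hpow (W : ValuationSubring E) (x : E) (n : ℕ) (hn : n ≠ 0): x ^ n ∈ W ↔ x ∈ W := by
    rw [← W.valuation_le_one_iff, ← W.valuation_le_one_iff, map_pow, pow_le_one_iff hn]
  obtain ⟨σ, hσ⟩ := exists_algEquiv_mem_iff_of_isGalois (F := perfectClosure F E) W₁ W₂ (by
    ext x
    obtain ⟨n, y, hy⟩ := (mem_perfectClosure_iff_pow_mem q).1 x.2
    have hq : q ^ n ≠ 0 := pow_ne_zero n (expChar_pos F q).ne'
    have hx (W : ValuationSubring E) : (x : E) ∈ W ↔ y ∈ W.comap (algebraMap F E) := by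
      rw [mem_comap, hy, hpow W _ _ hq]
    exact (hx W₁).trans (h ▸ (hx W₂).symm))
  exact ⟨σ.restrictScalars F, hσ⟩

theorem ValuationSubring.henselianLocalRing {E : Type*} [Field E] [IsAlgClosed E]
    (W : ValuationSubring E) : HenselianLocalRing W where
  is_henselian f hf a₀ h₀ _ := by
    set g : E[X] := f.map (algebraMap W E) with hg
    have hgm : g.Monic := hf.map _
    have hlt : W.valuation (g.eval (a₀ : E)) < 1 := by
      have : g.eval (a₀ : E) = ((f.eval a₀ : W) : E) := by
        rw [hg, eval_map_algebraMap]
        exact aeval_algebraMap_apply_eq_algebraMap_eval a₀ f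
      rw [this]
      exact (W.valuation_lt_one_iff _).1 h₀
    obtain ⟨α, hα, hαlt⟩ : ∃ α ∈ g.roots, W.valuation ((a₀ : E) - α) < 1 := by
      by_contra! hall
      refine hlt.not_ge ?_
      rw [(IsAlgClosed.splits g).eval_eq_prod_roots_of_monic hgm, map_multiset_prod,
        Multiset.map_map]
      exact Multiset.one_le_prod_of_one_le fun y hy => by
        obtain ⟨α, hα, rfl⟩ := Multiset.mem_map.1 hy
        exact hall α hα
    have hαW : α ∈ W := by
      have := sub_mem a₀.2 ((W.valuation_le_one_iff _).1 hαlt.le)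
      rwa [sub_sub_cancel] at this
    refine ⟨⟨α, hαW⟩, ?_, ?_⟩
    · have := (mem_roots hgm.ne_zero).1 hα
      exact IsRoot.of_map (f := algebraMap W E) (x := ⟨α, hαW⟩) this Subtype.val_injective
    · rw [W.valuation_lt_one_iff, ← Valuation.map_neg]
      simpa using hαlt

theorem ValuationSubring.inv_mem_of_le_toLocalSubring {E : Type*} [Field E] {A : LocalSubring E}
    {O : ValuationSubring E} (h : A ≤ O.toLocalSubring) {x : E} (hx : x ∈ A.toSubring)
    (hx0 : x ≠ 0) (hxO : x⁻¹ ∈ O) : x⁻¹ ∈ A.toSubring := by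
  have hu : IsUnit (Subring.inclusion h.1 ⟨x, hx⟩) :=
    isUnit_iff_exists_inv.2 ⟨⟨x⁻¹, hxO⟩, Subtype.ext (mul_inv_cancel₀ hx0)⟩
  obtain ⟨y, hy⟩ := isUnit_iff_exists_inv.1 (h.2.1 _ hu)
  have : (y : E) = x⁻¹ := eq_inv_of_mul_eq_one_right (congrArg Subtype.val hy)
  exact this ▸ y.2

/-- If `V` is a valuation subring contained in the comap of `W`, and the non-units of `V` are
mapped to non-units of `W`, then `V` is the comap of `W`. -/
theorem ValuationSubring.comap_eq_of_forall_mem {F E : Type*} [Field F] [Field E] {f : F →+* E}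
    {V : ValuationSubring F} {W : ValuationSubring E} (h : ∀ a ∈ V, f a ∈ W)
    (h' : ∀ a ∈ V.nonunits, f a ∈ W.nonunits) : W.comap f = V := by
  refine le_antisymm (fun a ha => ?_) h
  by_contra haV
  have ha0 : a ≠ 0 := by rintro rfl; exact haV V.zero_mem
  have := h' a⁻¹ ((mem_nonunits_iff_or _).2 (.inr (by rwa [inv_inv])))
  rw [mem_nonunits_iff_or, map_inv₀, inv_inv] at this
  exact this.elim (by simpa using ha0) fun h => h ha

theorem ValuationSubring.exists_comap_eq {F E : Type*} [Field F] [Field E] (f : F →+* E)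
    (V : ValuationSubring F) : ∃ W : ValuationSubring E, W.comap f = V := by
  obtain ⟨W, hW⟩ := (V.toLocalSubring.map f).exists_le_valuationSubring
  have hmem (a : F) (ha : a ∈ V) : f a ∈ (V.toLocalSubring.map f).toSubring := ⟨a, ha, rfl⟩
  refine ⟨W, comap_eq_of_forall_mem (fun a ha => hW.1 (hmem a ha)) fun a ha => ?_⟩
  rw [mem_nonunits_iff_or]
  by_contra! hcon
  obtain ⟨b, hb, hab⟩ := inv_mem_of_le_toLocalSubring hW
    (hmem a ((V.valuation_le_one_iff a).1 (le_of_lt ha))) hcon.1 hcon.2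
  rw [← map_inv₀] at hab
  obtain rfl := f.injective hab
  exact ((mem_nonunits_iff_or _).1 ha).elim (fun h => hcon.1 (by rw [h, map_zero])) fun h => h hb

open Algebra in
theorem LocalSubring.exists_le_valuationSubring_of_not_isIntegral {E : Type*} [Field E]
    {x : E} {R : LocalSubring E} (hxR : ¬ IsIntegral R.toSubring x) :
    ∃ V : ValuationSubring E, R ≤ V.toLocalSubring ∧ x ∉ V := by
  obtain rfl | hx0 := eq_or_ne x 0
  · exact (hxR isIntegral_zero).elim
  let := invertibleOfNonzero hx0
  let B := R.toSubring[x⁻¹]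
  let xinv : B.toSubring := ⟨x⁻¹, subset_adjoin rfl⟩
  have : (maximalIdeal R.toSubring).map (algebraMap _ B) + .span {xinv} ≠ ⊤ := fun eq ↦ hxR <|
    have ⟨p, hp, hpx⟩ := exists_aeval_invOf_eq_zero_of_idealMap_adjoin_sup_span_eq_top _ _
      (maximalIdeal.isMaximal R.toSubring).ne_top eq
    have H : IsUnit p.leadingCoeff := of_not_not fun h ↦ by simpa using sub_mem h hp
    ⟨.C H.unit⁻¹.1 * p, by simp [Polynomial.Monic], by simpa using .inr hpx⟩
  have ⟨V, hV⟩ := Ideal.image_subset_nonunits_valuationSubring (A := B.toSubring) _ this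
  refine ⟨V, ⟨fun r hr ↦ hV.1 (B.algebraMap_mem ⟨r, hr⟩),
    ((local_hom_TFAE _).out 3 0).mp fun r hr ↦ ?_⟩, (V.inv_mem_nonunits_iff.mp <|
      hV.2 ⟨_, le_add_self (α := Ideal B) (Ideal.subset_span rfl), rfl⟩).resolve_left hx0⟩
  rw [← V.image_maximalIdeal] at hV
  obtain ⟨⟨r, _⟩, hr, rfl⟩ := hV.2 ⟨_, le_self_add (α := Ideal B) (Ideal.mem_map_of_mem _ hr), rfl⟩
  exact hr

theorem ValuationSubring.isLocalHom_codRestrict {A F : Type*} [CommRing A] [IsLocalRing A]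
    [Field F] {φ : A →+* F} (W : ValuationSubring F) (h : ∀ a, φ a ∈ W)
    (h' : ∀ a ∈ maximalIdeal A, φ a ∈ W.nonunits) : IsLocalHom (φ.codRestrict W h) where
  map_nonunit a ha := by
    by_contra hcon
    exact ValuationSubring.coe_mem_nonunits_iff.1 (h' a hcon) ha

theorem ValuationSubring.valuation_eq_one_of_mem_of_inv_mem {F : Type*} [Field F]
    (W : ValuationSubring F) {x : F} (hx0 : x ≠ 0) (hx : x ∈ W) (hx' : x⁻¹ ∈ W) :
    W.valuation x = 1 := by
  rw [← W.valuation_le_one_iff] at hx hx'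
  rw [map_inv₀, inv_le_one₀ (zero_lt_iff.2 (by simpa using hx0))] at hx'
  exact le_antisymm hx hx'

theorem ValuationSubring.mem_of_monic_of_eval_eq_zero {F : Type*} [Field F]
    (W : ValuationSubring F) {q : F[X]} (hq : q.Monic) (hW : ∀ i, q.coeff i ∈ W) {x : F}
    (hx : q.eval x = 0) : x ∈ W := by
  have hT : (q.coeffs : Set F) ⊆ W.toSubring := fun y hy => by
    obtain ⟨i, -, rfl⟩ := mem_coeffs_iff.1 hy
    exact hW i
  refine LocalSubring.mem_of_isMax_of_isIntegral (R := W.toLocalSubring) W.isMax_toLocalSubring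
    ⟨q.toSubring W.toSubring hT, (monic_toSubring _ _ _).2 hq, ?_⟩
  have : (q.toSubring W.toSubring hT).map W.toSubring.subtype = q := map_toSubring _ _ _
  exact (Polynomial.eval_map _ _).symm.trans ((congrArg (eval x) this).trans hx)

theorem RZPoint.ext_val {A F : Type u} [CommRing A] [IsLocalRing A] [Field F] {φ : A →+* F}
    {v w : RZPoint φ} (h : v.val = w.val) : v = w := by
  cases v; cases w; cases h; rfl

theorem RZPoint.mem_nonunits {A F : Type u} [CommRing A] [IsLocalRing A] [Field F]
    {φ : A →+* F} (v : RZPoint φ) {a : A} (ha : a ∈ maximalIdeal A) : φ a ∈ v.val.nonunits :=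
  ValuationSubring.coe_mem_nonunits_iff.2 (v.dom_lt a ha)

/-- The point of the Riemann–Zariski space given by a valuation subring dominating `A`. -/
def RZPoint.ofMem {A F : Type u} [CommRing A] [IsLocalRing A] [Field F]
    {φ : A →+* F} (W : ValuationSubring F) (h : ∀ a, φ a ∈ W)
    (h' : ∀ a ∈ maximalIdeal A, φ a ∈ W.nonunits) : RZPoint φ where
  val := W
  dom_le := h
  dom_lt a ha := ValuationSubring.coe_mem_nonunits_iff.1 (h' a ha)

theorem RZPoint.eventually_mem_val {A F : Type u} [CommRing A] [IsLocalRing A] [Field F]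
    {φ : A →+* F} {v : RZPoint φ} {f : F} (hf : f ∈ v.val) :
    ∀ᶠ w : RZPoint φ in nhds v, f ∈ w.val :=
  IsOpen.mem_nhds (TopologicalSpace.isOpen_generateFrom_of_mem ⟨f, rfl⟩) hf

/-- `R'` is a henselization of the local ring `R`: it is initial among the henselian local rings
under `R`, with respect to local homomorphisms. -/
structure IsHenselization (R R' : Type u) [CommRing R] [IsLocalRing R] [CommRing R']
    [HenselianLocalRing R'] [Algebra R R'] : Prop where
  isLocalHom : IsLocalHom (algebraMap R R')
  existsUnique : ∀ (S : Type u) [CommRing S] [HenselianLocalRing S]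
    (ψ : R →+* S), IsLocalHom ψ →
      ∃! ψ' : R' →+* S, IsLocalHom ψ' ∧ ψ'.comp (algebraMap R R') = ψ

namespace IsHenselization

variable {R R' : Type u} [CommRing R] [IsLocalRing R] [CommRing R']
  [HenselianLocalRing R'] [Algebra R R']

theorem ringHom_ext (H : IsHenselization R R') {S : Type u} [CommRing S] [HenselianLocalRing S]
    {f g : R' →+* S} (hf : IsLocalHom f) (hg : IsLocalHom g)
    (h : f.comp (algebraMap R R') = g.comp (algebraMap R R')) : f = g :=
  have := H.isLocalHom
  (H.existsUnique S (f.comp (algebraMap R R')) inferInstance).unique ⟨hf, rfl⟩ ⟨hg, h.symm⟩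

theorem exists_sub_mem_maximalIdeal (H : IsHenselization R R') (r : R') :
    ∃ c : R, r - algebraMap R R' c ∈ maximalIdeal R' := by
  have := H.isLocalHom
  obtain ⟨f, ⟨_, hf⟩, -⟩ := H.existsUnique (ResidueField R) (residue R) inferInstance
  have key : (ResidueField.map (algebraMap R R')).comp f = residue R' :=
    H.ringHom_ext inferInstance inferInstance (by rw [RingHom.comp_assoc, hf]; rfl)
  obtain ⟨c, hc⟩ := residue_surjective (f r)
  refine ⟨c, ?_⟩
  rw [← residue_eq_zero_iff, map_sub, sub_eq_zero, ← key, RingHom.comp_apply,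
    RingHom.comp_apply, ← hc, ← RingHom.comp_apply f, hf]

theorem mem_of_subring (H : IsHenselization R R') (T : Subring R') [HenselianLocalRing T]
    [IsLocalHom T.subtype] (hT : ∀ c, algebraMap R R' c ∈ T) (r : R') : r ∈ T := by
  have := H.isLocalHom
  let ψ : R →+* T := (algebraMap R R').codRestrict T hT
  have : IsLocalHom (T.subtype.comp ψ) := H.isLocalHom
  obtain ⟨f, ⟨_, hf⟩, -⟩ := H.existsUnique T ψ (isLocalHom_of_comp ψ T.subtype)
  have key : T.subtype.comp f = RingHom.id R' :=
    H.ringHom_ext inferInstance inferInstance (by rw [RingHom.comp_assoc, hf]; rfl)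
  have : (f r : R') = r := congrArg (fun g => g r) key
  exact this ▸ (f r).2

theorem isAlgebraic (H : IsHenselization R R') (K L : Type*) [Field K] [Field L]
    [Algebra R K] [Algebra R L] [Algebra K L] [Algebra R' L]
    [IsScalarTower R K L] [IsScalarTower R R' L] [IsFractionRing R' L] :
    Algebra.IsAlgebraic K L := by
  let T : Subring R' := (algebraicClosure K L).toSubring.comap (algebraMap R' L)
  have hTmem (r : R') : r ∈ T ↔ algebraMap R' L r ∈ algebraicClosure K L := Iff.rfl
  have hloc : IsLocalHom T.subtype := ⟨fun t ht => by
    obtain ⟨u, hu⟩ := isUnit_iff_exists_inv.1 ht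
    have huT : u ∈ T := by
      have : algebraMap R' L u = (algebraMap R' L t)⁻¹ :=
        eq_inv_of_mul_eq_one_right (by rw [← map_mul]; simpa using congrArg (algebraMap R' L) hu)
      rw [hTmem, this]
      exact inv_mem t.2
    exact isUnit_iff_exists_inv.2 ⟨⟨u, huT⟩, Subtype.ext hu⟩⟩
  have hTlocal : IsLocalRing T := RingHom.domain_isLocalRing T.subtype
  have hTm (t : T) : t ∈ maximalIdeal T ↔ (t : R') ∈ maximalIdeal R' := by
    simp only [mem_maximalIdeal, mem_nonunits_iff]
    exact (isUnit_map_iff T.subtype t).not.symm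
  have hTh : HenselianLocalRing T := ⟨fun f hf a₀ h₀ h₁ => by
    obtain ⟨a, ha, haa⟩ := HenselianLocalRing.is_henselian (f.map T.subtype) (hf.map _) (a₀ : R')
      (by
        have := (hTm _).1 h₀
        rwa [← T.subtype_apply, ← Polynomial.eval_map_apply] at this)
      (by
        rw [derivative_map]
        have := h₁.map T.subtype
        rwa [← Polynomial.eval_map_apply] at this)
    have haT : a ∈ T := by
      let φ : T →+* algebraicClosure K L :=
        ((algebraMap R' L).comp T.subtype).codRestrict (algebraicClosure K L) fun t => t.2
      have : IsIntegral (algebraicClosure K L) (algebraMap R' L a) := by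
        refine ⟨f.map φ, hf.map φ, ?_⟩
        rw [eval₂_map]
        have := congrArg (algebraMap R' L) ha.eq_zero
        rw [Polynomial.eval_map, hom_eval₂, map_zero] at this
        exact this
      exact mem_algebraicClosure_iff.2 (isIntegral_trans (R := K) _ this).isAlgebraic
    exact ⟨⟨a, haT⟩, IsRoot.of_map (f := T.subtype) (x := ⟨a, haT⟩) ha Subtype.val_injective,
      (hTm _).2 haa⟩⟩
  have hmem (r : R') : IsAlgebraic K (algebraMap R' L r) :=
    mem_algebraicClosure_iff.1 <| H.mem_of_subring T (fun c => by
      rw [hTmem, ← IsScalarTower.algebraMap_apply, IsScalarTower.algebraMap_apply R K L]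
      exact algebraMap_mem _ _) r
  refine ⟨fun z => ?_⟩
  obtain ⟨a, b, -, rfl⟩ := IsFractionRing.div_surjective (A := R') z
  rw [div_eq_mul_inv]
  exact (hmem a).mul (hmem b).inv

variable {K L : Type u} [Field K] [Field L] [Algebra R K] [Algebra R L]
  [Algebra K L] [Algebra R' L] [IsScalarTower R K L] [IsScalarTower R R' L]

theorem exists_comap_eq (H : IsHenselization R R') [IsFractionRing R K] [IsFractionRing R' L]
    (V : RZPoint (algebraMap R K)) :
    ∃ ν : RZPoint (algebraMap R' L), ν.val.comap (algebraMap K L) = V.val := by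
  have := H.isAlgebraic K L
  let E := AlgebraicClosure L
  obtain ⟨W, hW⟩ := V.val.exists_comap_eq (algebraMap K E)
  have := W.henselianLocalRing
  have hRE (a : R) : algebraMap R E a = algebraMap K E (algebraMap R K a) :=
    IsScalarTower.algebraMap_apply R K E a
  have h (a : R) : algebraMap R E a ∈ W := by
    rw [hRE, ← ValuationSubring.mem_comap, hW]
    exact V.dom_le a
  have h' (a : R) (ha : a ∈ maximalIdeal R) : algebraMap R E a ∈ W.nonunits := by
    rw [hRE, ← ValuationSubring.mem_nonunits_comap, hW]
    exact V.mem_nonunits ha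
  obtain ⟨ψ, ⟨hψloc, hψ⟩, -⟩ := H.existsUnique W _ (W.isLocalHom_codRestrict h h')
  let g : R' →+* E := W.subtype.comp ψ
  have hg (a : R) : g (algebraMap R R' a) = algebraMap R E a :=
    congrArg (fun f => ((f a : W) : E)) hψ
  have : IsDomain R := (IsFractionRing.injective R K).isDomain _
  have : IsDomain R' := (IsFractionRing.injective R' L).isDomain _
  have hginj : Function.Injective g := by
    rw [injective_iff_map_eq_zero]
    intro r hr
    by_contra hr0
    have halg : IsAlgebraic R r := by
      rw [← isAlgebraic_algebraMap_iff (IsFractionRing.injective R' L),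
        IsFractionRing.isAlgebraic_iff R K L]
      exact Algebra.IsAlgebraic.isAlgebraic _
    obtain ⟨c, hc0, s, hs⟩ := halg.exists_nonzero_dvd (mem_nonZeroDivisors_of_ne_zero hr0)
    have : algebraMap R E c = 0 := by rw [← hg, hs, map_mul, hr, zero_mul]
    rw [hRE, map_eq_zero] at this
    exact hc0 ((injective_iff_map_eq_zero _).1 (IsFractionRing.injective R K) c this)
  let ι : L →+* E := IsFractionRing.lift hginj
  have hι (r : R') : ι (algebraMap R' L r) = g r := IsFractionRing.lift_algebraMap hginj r
  have hιK : ι.comp (algebraMap K L) = algebraMap K E := by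
    refine IsLocalization.ringHom_ext (nonZeroDivisors R) (RingHom.ext fun a => ?_)
    simp only [RingHom.comp_apply]
    rw [← IsScalarTower.algebraMap_apply, IsScalarTower.algebraMap_apply R R' L, hι, hg, hRE]
  refine ⟨.ofMem (W.comap ι) (fun r => ?_) fun r hr => ?_, ?_⟩
  · rw [ValuationSubring.mem_comap, hι]
    exact (ψ r).2
  · rw [ValuationSubring.mem_nonunits_comap, hι]
    have hle : maximalIdeal R' ≤ (maximalIdeal W).comap ψ := ((local_hom_TFAE ψ).out 0 3).1 hψloc
    exact ValuationSubring.coe_mem_nonunits_iff.2 (hle hr)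
  · rw [← hW, ← hιK]
    rfl

theorem eq_of_comap_eq (H : IsHenselization R R') [IsFractionRing R' L]
    {ν₁ ν₂ : RZPoint (algebraMap R' L)}
    (h : ν₁.val.comap (algebraMap K L) = ν₂.val.comap (algebraMap K L)) : ν₁ = ν₂ := by
  have := H.isAlgebraic K L
  have hloc := H.isLocalHom
  let E := AlgebraicClosure L
  have : Algebra.IsAlgebraic K E := .trans K L E
  obtain ⟨W₁, hW₁⟩ := ν₁.val.exists_comap_eq (algebraMap L E)
  obtain ⟨W₂, hW₂⟩ := ν₂.val.exists_comap_eq (algebraMap L E)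
  obtain ⟨σ, hσ⟩ := W₁.exists_algEquiv_mem_iff (F := K) W₂ (by
    rw [IsScalarTower.algebraMap_eq K L E, ← ValuationSubring.comap_comap,
      ← ValuationSubring.comap_comap, hW₁, hW₂, h])
  have hσ' (x : E) : x ∈ W₁.nonunits ↔ σ x ∈ W₂.nonunits := by
    rw [ValuationSubring.mem_nonunits_iff_or, ValuationSubring.mem_nonunits_iff_or, ← map_inv₀,
      ← hσ, map_eq_zero]
  have hRE (a : R') : algebraMap R' E a = algebraMap L E (algebraMap R' L a) :=
    IsScalarTower.algebraMap_apply R' L E a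
  have := W₂.henselianLocalRing
  have h₂ (a : R') : algebraMap R' E a ∈ W₂ := by
    rw [hRE, ← ValuationSubring.mem_comap, hW₂]
    exact ν₂.dom_le a
  have h₁ (a : R') : (σ : E →+* E).comp (algebraMap R' E) a ∈ W₂ := by
    refine (hσ _).1 ?_
    rw [hRE, ← ValuationSubring.mem_comap, hW₁]
    exact ν₁.dom_le a
  have key := H.ringHom_ext
    (W₂.isLocalHom_codRestrict h₁ fun a ha => by
      refine (hσ' _).1 ?_
      rw [hRE, ← ValuationSubring.mem_nonunits_comap, hW₁]
      exact ν₁.mem_nonunits ha)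
    (W₂.isLocalHom_codRestrict h₂ fun a ha => by
      rw [hRE, ← ValuationSubring.mem_nonunits_comap, hW₂]
      exact ν₂.mem_nonunits ha)
    (by
      ext a
      change σ (algebraMap R' E (algebraMap R R' a)) = algebraMap R' E (algebraMap R R' a)
      rw [← IsScalarTower.algebraMap_apply, IsScalarTower.algebraMap_apply R K E, σ.commutes])
  have hfix : (σ : E →+* E).comp (algebraMap L E) = algebraMap L E := by
    refine IsLocalization.ringHom_ext (nonZeroDivisors R') (RingHom.ext fun a => ?_)
    exact congrArg (fun f => ((f a : W₂) : E)) key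
  refine RZPoint.ext_val ?_
  ext x
  rw [← hW₁, ← hW₂, ValuationSubring.mem_comap, ValuationSubring.mem_comap, hσ]
  exact iff_of_eq (congrArg (· ∈ W₂) (congrArg (fun f => f x) hfix))

/-- The restriction map on Riemann–Zariski spaces. -/
def restrict (hloc : IsLocalHom (algebraMap R R')) (ν : RZPoint (algebraMap R' L)) :
    RZPoint (algebraMap R K) :=
  .ofMem (ν.val.comap (algebraMap K L))
    (fun a => by
      rw [ValuationSubring.mem_comap, ← IsScalarTower.algebraMap_apply,
        IsScalarTower.algebraMap_apply R R' L]
      exact ν.dom_le _)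
    (fun a ha => by
      rw [ValuationSubring.mem_nonunits_comap, ← IsScalarTower.algebraMap_apply,
        IsScalarTower.algebraMap_apply R R' L]
      have hle : maximalIdeal R ≤ (maximalIdeal R').comap (algebraMap R R') :=
        ((local_hom_TFAE _).out 0 3).1 hloc
      exact ν.mem_nonunits (hle ha))

theorem continuous_restrict (hloc : IsLocalHom (algebraMap R R')) :
    Continuous (restrict (K := K) (L := L) hloc) := by
  refine continuous_generateFrom_iff.2 ?_
  rintro _ ⟨f, rfl⟩
  exact TopologicalSpace.isOpen_generateFrom_of_mem ⟨algebraMap K L f, rfl⟩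

/-- The elements of `L` which agree, up to non-units, with an element of `K` in a whole
neighbourhood of `V`. -/
def approxSubring (hloc : IsLocalHom (algebraMap R R')) (V : RZPoint (algebraMap R K)) :
    Subring L where
  carrier := {y | ∃ c ∈ V.val, ∀ᶠ ν : RZPoint (algebraMap R' L) in
    (nhds V).comap (restrict hloc), y - algebraMap K L c ∈ ν.val.nonunits}
  zero_mem' := ⟨0, zero_mem _, .of_forall fun ν => by simp⟩
  one_mem' := ⟨1, one_mem _, .of_forall fun ν => by simp⟩
  add_mem' := by
    rintro y z ⟨c, hc, hyc⟩ ⟨d, hd, hzd⟩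
    refine ⟨c + d, add_mem hc hd, hyc.mp (hzd.mono fun ν h₁ h₂ => ?_)⟩
    rw [map_add, add_sub_add_comm]
    exact Valuation.map_add_lt ν.val.valuation h₂ h₁
  neg_mem' := by
    rintro y ⟨c, hc, hyc⟩
    refine ⟨-c, neg_mem hc, hyc.mono fun ν h => ?_⟩
    rwa [map_neg, ← neg_sub', ValuationSubring.mem_nonunits_iff, Valuation.map_neg]
  mul_mem' := by
    rintro y z ⟨c, hc, hyc⟩ ⟨d, hd, hzd⟩
    refine ⟨c * d, mul_mem hc hd, ?_⟩
    filter_upwards [hyc, hzd, (RZPoint.eventually_mem_val hc).comap (restrict hloc),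
      (RZPoint.eventually_mem_val hd).comap (restrict hloc)] with ν h₁ h₂ h₃ h₄
    have h₃' : ν.val.valuation (algebraMap K L c) ≤ 1 := (ν.val.valuation_le_one_iff _).2 h₃
    have h₄' : ν.val.valuation (algebraMap K L d) ≤ 1 := (ν.val.valuation_le_one_iff _).2 h₄
    have h₅ : ν.val.valuation z ≤ 1 := by
      rw [← sub_add_cancel z (algebraMap K L d)]
      exact Valuation.map_add_le _ (le_of_lt h₂) h₄'
    have : y * z - algebraMap K L (c * d) =
        (y - algebraMap K L c) * z + algebraMap K L c * (z - algebraMap K L d) := by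
      rw [map_mul]; ring
    rw [this]
    refine Valuation.map_add_lt ν.val.valuation ?_ ?_
    · rw [map_mul]; exact mul_lt_one_of_lt_of_le h₁ h₅
    · rw [map_mul, mul_comm]; exact mul_lt_one_of_lt_of_le h₂ h₃'

theorem eventually_mem_of_mem_approxSubring {hloc : IsLocalHom (algebraMap R R')}
    {V : RZPoint (algebraMap R K)} {y : L} (hy : y ∈ approxSubring (R' := R') hloc V) :
    ∀ᶠ ν : RZPoint (algebraMap R' L) in (nhds V).comap (restrict hloc), y ∈ ν.val := by
  obtain ⟨c, hc, hyc⟩ := hy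
  filter_upwards [hyc, (RZPoint.eventually_mem_val hc).comap (restrict hloc)] with ν h₁ h₂
  rw [← ν.val.valuation_le_one_iff, ← sub_add_cancel y (algebraMap K L c)]
  exact Valuation.map_add_le _ (le_of_lt h₁) ((ν.val.valuation_le_one_iff _).2 h₂)

theorem eventually_comap_self {hloc : IsLocalHom (algebraMap R R')}
    {ν : RZPoint (algebraMap R' L)} {p : RZPoint (algebraMap R' L) → Prop}
    (h : ∀ᶠ μ in (nhds (restrict (K := K) hloc ν)).comap (restrict hloc), p μ) : p ν :=
  (Filter.map_le_iff_le_comap.1 (by simpa using pure_le_nhds _) : pure ν ≤ _) h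

theorem isInducing_restrict (H : IsHenselization R R') [IsFractionRing R' L] :
    Topology.IsInducing (restrict (K := K) (L := L) H.isLocalHom) := by
  have hloc := H.isLocalHom
  refine Topology.isInducing_iff_nhds.2 fun ν => le_antisymm
    (Filter.map_le_iff_le_comap.1 (continuous_restrict hloc).continuousAt) ?_
  refine le_of_le_of_eq (le_iInf₂ ?_) TopologicalSpace.nhds_generateFrom.symm
  refine fun _ hs => ?_
  obtain ⟨hf, f, rfl⟩ := hs
  rw [Filter.le_principal_iff]
  change f ∈ ν.val at hf
  set V := restrict (K := K) hloc ν with hV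
  let G : Subring L := approxSubring (R' := R') hloc V
  have hGν : G ≤ ν.val.toSubring := fun y hy =>
    eventually_comap_self (eventually_mem_of_mem_approxSubring hy)
  have hVG (c : K) (hc : c ∈ V.val) : algebraMap K L c ∈ G :=
    ⟨c, hc, .of_forall fun μ => by simp⟩
  have hR'G (r : R') : algebraMap R' L r ∈ G := by
    obtain ⟨c, hc⟩ := H.exists_sub_mem_maximalIdeal r
    refine ⟨algebraMap R K c, V.dom_le c, .of_forall fun μ => ?_⟩
    rw [← IsScalarTower.algebraMap_apply, IsScalarTower.algebraMap_apply R R' L, ← map_sub]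
    exact μ.mem_nonunits hc
  have hinv (y : L) (hy : y ∈ G) (hy0 : y ≠ 0) (hyν : y⁻¹ ∈ ν.val) : y⁻¹ ∈ G := by
    have hy1 := ν.val.valuation_eq_one_of_mem_of_inv_mem hy0 (hGν hy) hyν
    obtain ⟨c, hc, hyc⟩ := hy
    have hc1 : ν.val.valuation (algebraMap K L c) = 1 := by
      have := (Valuation.map_sub_swap _ _ _).trans_lt
        (show ν.val.valuation (y - algebraMap K L c) < 1 from eventually_comap_self hyc)
      rw [← hy1] at this ⊢
      exact Valuation.map_eq_of_sub_lt _ this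
    have hc0 : algebraMap K L c ≠ 0 := by
      intro h
      simp [h] at hc1
    have hcV : c⁻¹ ∈ V.val := by
      change algebraMap K L c⁻¹ ∈ ν.val
      rw [← ν.val.valuation_le_one_iff, map_inv₀, map_inv₀, hc1, inv_one]
    refine ⟨c⁻¹, hcV, ?_⟩
    filter_upwards [hyc, (RZPoint.eventually_mem_val hc).comap (restrict hloc),
      (RZPoint.eventually_mem_val hcV).comap (restrict hloc)] with μ h₁ h₂ h₃
    change μ.val.valuation _ < 1 at h₁
    have hc1 := μ.val.valuation_eq_one_of_mem_of_inv_mem hc0 h₂ (map_inv₀ (algebraMap K L) c ▸ h₃)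
    have hy1 : μ.val.valuation y = 1 := by
      rw [← hc1] at h₁ ⊢
      exact Valuation.map_eq_of_sub_lt _ h₁
    change μ.val.valuation _ < 1
    rw [map_inv₀, inv_sub_inv hy0 hc0, map_div₀, map_mul, hy1, hc1, one_mul, div_one,
      Valuation.map_sub_swap]
    exact h₁
  have : IsLocalHom (Subring.inclusion hGν) := ⟨fun y hy => by
    obtain ⟨u, hu⟩ := isUnit_iff_exists_inv.1 hy
    have hu' : (y : L) * u = 1 := congrArg Subtype.val hu
    have hinv' : (u : L) = (y : L)⁻¹ := eq_inv_of_mul_eq_one_right hu'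
    exact isUnit_iff_exists_inv.2 ⟨⟨u, hinv' ▸ hinv y y.2 (left_ne_zero_of_mul_eq_one hu')
      (hinv' ▸ u.2)⟩, Subtype.ext hu'⟩⟩
  have : IsLocalRing G := RingHom.domain_isLocalRing (S := ν.val) (Subring.inclusion hGν)
  let A : LocalSubring L := ⟨G⟩
  have hint : IsIntegral A.toSubring f := by
    by_contra hcon
    obtain ⟨O, hO, hfO⟩ := LocalSubring.exists_le_valuationSubring_of_not_isIntegral hcon
    have hnon (y : L) (hy : y ∈ G) (hyν : y ∈ ν.val.nonunits) : y ∈ O.nonunits := by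
      rw [ValuationSubring.mem_nonunits_iff_or] at hyν ⊢
      by_contra! h
      exact hyν.elim h.1 fun h' =>
        h' (hGν (ValuationSubring.inv_mem_of_le_toLocalSubring hO hy h.1 h.2))
    let μ : RZPoint (algebraMap R' L) := .ofMem O (fun r => hO.1 (hR'G r))
      fun r hr => hnon _ (hR'G r) (ν.mem_nonunits hr)
    have hμ : μ = ν := H.eq_of_comap_eq (K := K) <|
      ValuationSubring.comap_eq_of_forall_mem (fun a ha => hO.1 (hVG a ha)) fun a ha =>
        hnon _ (hVG a ((V.val.valuation_le_one_iff a).1 (le_of_lt ha)))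
          (ValuationSubring.mem_nonunits_comap.1 ha)
    have hOν : O = ν.val := congrArg RZPoint.val hμ
    exact hfO (hOν ▸ hf)
  obtain ⟨p, hp, hpf⟩ := hint
  have hcoeff : ∀ᶠ μ : RZPoint (algebraMap R' L) in (nhds V).comap (restrict hloc),
      ∀ i ∈ p.support, (p.coeff i : L) ∈ μ.val :=
    (Filter.eventually_all_finset _).2 fun i _ =>
      eventually_mem_of_mem_approxSubring (p.coeff i).2
  filter_upwards [hcoeff] with μ hμ
  refine μ.val.mem_of_monic_of_eval_eq_zero (hp.map A.toSubring.subtype) (fun i => ?_)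
    ((Polynomial.eval_map _ _).trans hpf)
  rw [coeff_map]
  by_cases hi : i ∈ p.support
  · exact hμ i hi
  · rw [notMem_support_iff.1 hi, map_zero]
    exact zero_mem _

theorem exists_homeomorph (H : IsHenselization R R') [IsFractionRing R K] [IsFractionRing R' L] :
    ∃ h : RZPoint (algebraMap R' L) ≃ₜ RZPoint (algebraMap R K),
      ∀ ν, (h ν).val = ν.val.comap (algebraMap K L) := by
  have hbij : Function.Bijective (restrict (K := K) (L := L) H.isLocalHom) :=
    ⟨fun ν₁ ν₂ h => H.eq_of_comap_eq (K := K) (congrArg RZPoint.val h), fun V =>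
      (H.exists_comap_eq V).imp fun ν hν => RZPoint.ext_val hν⟩
  exact ⟨(Equiv.ofBijective _ hbij).toHomeomorphOfIsInducing H.isInducing_restrict, fun ν => rfl⟩

end IsHenselization

end

/-- Let `X` be an algebraic variety over an algebraically closed field
`k` with function field `K`, and let `x ∈ X` be a closed point at which `X` is
analytically irreducible.  Let `R̃` be the henselization of `R = 𝒪_{X,x}` (a henselian
local ring with a local map `ρ : R → R̃` which is universal among local maps to
henselian local rings), an integral domain with fraction field `K̃`, and let
`RZ̃(X,x)` be the space of valuations of `K̃` whose valuation ring dominates `R̃`, with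
the Zariski topology.  Then the map `RZ̃(X,x) → RZ(X,x)` sending `ν̃` to its restriction
along `ρ_K : K ↪ K̃` is a homeomorphism. -/
theorem statement_11 {k : Type u} [Field k] [IsAlgClosed k]
    (X : Scheme.{u}) [IsIntegral X] (sπ : X ⟶ Spec (CommRingCat.of k))
    [IsSeparated sπ] [LocallyOfFiniteType sπ] [QuasiCompact sπ]
    (x : X) (hx : IsClosed ({x} : Set X))
    -- analytic irreducibility of `X` at `x`:
    (hirr : IsDomain
      (AdicCompletion (IsLocalRing.maximalIdeal (X.presheaf.stalk x))
        (X.presheaf.stalk x)))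
    -- the henselization `R̃` of `R = 𝒪_{X,x}` (it is then an integral domain):
    (R' : Type u) [CommRing R'] [IsLocalRing R'] [HenselianLocalRing R'] [IsDomain R']
    (ρ : X.presheaf.stalk x →+* R') (hρ : IsLocalHom ρ)
    (huniv : ∀ (S : Type u) [CommRing S] [IsLocalRing S] [HenselianLocalRing S]
      (ψ : X.presheaf.stalk x →+* S), IsLocalHom ψ →
        ∃! ψ' : R' →+* S, IsLocalHom ψ' ∧ ψ'.comp ρ = ψ)
    -- the induced inclusion `ρ_K : K ↪ K̃` of fraction fields:
    (ρK : X.functionField →+* FractionRing R')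
    (hcomp : ρK.comp (stalkToFunctionField X x) =
      (algebraMap R' (FractionRing R')).comp ρ) :
    ∃ h : RZPoint (algebraMap R' (FractionRing R')) ≃ₜ RZ X x,
      ∀ ν : RZPoint (algebraMap R' (FractionRing R')),
        (h ν).val = ν.val.comap ρK := by
  let : Algebra (X.presheaf.stalk x) R' := ρ.toAlgebra
  let : Algebra X.functionField (FractionRing R') := ρK.toAlgebra
  have : IsScalarTower (X.presheaf.stalk x) X.functionField (FractionRing R') :=
    .of_algebraMap_eq' ((IsScalarTower.algebraMap_eq _ R' _).trans hcomp.symm)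
  have H : IsHenselization (X.presheaf.stalk x) R' := ⟨hρ, fun S _ _ ψ hψ => huniv S ψ hψ⟩
  exact H.exists_homeomorph (K := X.functionField) (L := FractionRing R')

end
end
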